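/- arXiv:2512.03865 — 2 statements merged into one kernel-verified Lean document; each statement's English description precedes it below -/
import Mathlib

section
/- Let ω ∈ ℝ and φ : 𝕋_1 → ℂ analytic with ‖φ'''‖_1 ≤ 1 (so in particular sup_{𝕋_1}|φ'| < 1), and let f, g be the analytic solutions of the adapted-coordinates system, with f(x,0) = g(x,0) = 0, written f(x,y) = y·f̄(x,y) and g(x,y) = y·ḡ(x,y). Then f̄ and ḡ are well-defined and analytic on the triangular domain D_λ with λ = (1 − |φ'|)², where |φ'| = sup_{𝕋_1}|φ'|, and they satisfy |f̄|^{(λ)} ≤ |φ'|(2−|φ'|)/(1−|φ'|)², |1+f̄|^{(λ)} ≤ 1/(1−|φ'|)², and |ḡ|^{(λ)} ≤ 2|φ'|(2+|φ'|)/(1−|φ'|)². -/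
/-!
Statement 14 (Lemma bar-fg-sup): the reduced functions `f̄`, `ḡ` of the adapted
coordinates (`f = y f̄`, `g = y ḡ`) are well defined and analytic on the triangular
domain `D_λ`, `λ = (1 − |φ'|)²`, with explicit sup-norm bounds.
-/

open Real Set ENNReal

noncomputable section

/-- The complex strip `𝕋_a`. -/
def strip (a : ℝ) : Set ℂ := {z : ℂ | |z.im| < a}

/-- The triangular domain `D_λ = {(x,y) ∈ 𝕋₁ × ℂ : |Im x| + |y|/λ < 1}`. -/
def Dtri (lam : ℝ) : Set (ℂ × ℂ) := {p : ℂ × ℂ | |p.1.im| + ‖p.2‖ / lam < 1}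

def Per1 (u : ℂ → ℂ) : Prop := ∀ z, u (z + 1) = u z

def Per1' (u : ℂ × ℂ → ℂ) : Prop := ∀ z w, u (z + 1, w) = u (z, w)

def fcoeff (u : ℂ → ℂ) (k : ℤ) : ℂ :=
  ∫ t in (0:ℝ)..1, u (t : ℂ) * Complex.exp (-(2 * (π : ℂ) * Complex.I * (k : ℂ) * (t : ℂ)))

def fwNormLE (u : ℂ → ℂ) (c : ℝ) : Prop :=
  Summable (fun k : ℤ => ‖fcoeff u k‖ * Real.exp (2 * π * |(k : ℝ)|)) ∧
    (∑' k : ℤ, ‖fcoeff u k‖ * Real.exp (2 * π * |(k : ℝ)|)) ≤ c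

/-- The sup "norm" `|u|^{(λ)}` on `D_λ`, valued in `[0,∞]`. -/
def triSup (lam : ℝ) (u : ℂ × ℂ → ℂ) : ℝ≥0∞ :=
  ⨆ p ∈ Dtri lam, (‖u p‖₊ : ℝ≥0∞)

/-- `|φ'| = sup_{𝕋₁} |φ'|`. -/
def phiDerSup (φ : ℂ → ℂ) : ℝ :=
  sSup ((fun z => ‖deriv φ z‖) '' strip 1)

section Helpers
open Filter Topology

def Qf (φ : ℂ → ℂ) (p : ℂ × ℂ) : ℂ := dslope φ p.1 (p.1 + p.2)

lemma Qf_mul (φ : ℂ → ℂ) (a k : ℂ) : k * Qf φ (a, k) = φ (a + k) - φ a := by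
  have := sub_smul_dslope φ a (a + k)
  simpa [Qf] using this

def opP : (ℂ × ℂ) →L[ℂ] (ℂ × ℂ) :=
  (ContinuousLinearMap.inr ℂ ℂ ℂ).comp (ContinuousLinearMap.snd ℂ ℂ ℂ)
def opN : (ℂ × ℂ) →L[ℂ] (ℂ × ℂ) :=
  (ContinuousLinearMap.inl ℂ ℂ ℂ).comp (ContinuousLinearMap.snd ℂ ℂ ℂ)
def opM (ε : ℂ) (p : ℂ × ℂ) : (ℂ × ℂ) →L[ℂ] (ℂ × ℂ) :=
  p.1 • (1 : (ℂ × ℂ) →L[ℂ] (ℂ × ℂ)) + p.2 • opP + ε • opN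

lemma opM_apply (ε : ℂ) (p : ℂ × ℂ) (v : ℂ × ℂ) :
    opM ε p v = (p.1 * v.1 + ε * v.2, (p.1 + p.2) * v.2) := by
  ext <;> simp [opM, opP, opN]; ring

lemma opM_zero : opM 0 (0, 0) = 0 := by
  ext <;> simp [opM_apply]

lemma opM_pow (ε : ℂ) (p : ℂ × ℂ) (n : ℕ) :
    ((opM ε p ^ n) (0, 1)).2 = (p.1 + p.2) ^ n ∧
    p.2 * ((opM ε p ^ n) (0, 1)).1 = ε * ((p.1 + p.2) ^ n - p.1 ^ n) := by
  induction n with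
  | zero => simp
  | succ n ih =>
    rw [pow_succ', mul_apply_eq_comp, opM_apply]
    refine ⟨by rw [ih.1]; ring, ?_⟩
    have h2 := ih.2
    simp only [ih.1]
    linear_combination p.1 * h2

lemma opM_analytic (ε : ℂ) (p : ℂ × ℂ) : AnalyticAt ℂ (opM ε) p := by
  unfold opM
  exact ((analyticAt_fst.smul analyticAt_const).add (analyticAt_snd.smul analyticAt_const)).add
    analyticAt_const

lemma exists_G (φ : ℂ → ℂ) (a : ℂ) (h : AnalyticAt ℂ φ a) :
    ∃ ε : ℂ, ε ≠ 0 ∧ ∃ G : ℂ × ℂ → ℂ, AnalyticAt ℂ G (0, 0) ∧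
      ∀ᶠ p in 𝓝 ((0, 0) : ℂ × ℂ), p.2 * G p = ε * (φ (a + p.1 + p.2) - φ (a + p.1)) := by
  obtain ⟨q, r, hq⟩ := h
  set c : ℕ → ℂ := q.coeff with hc
  set A := (ℂ × ℂ) →L[ℂ] (ℂ × ℂ)
  set S := FormalMultilinearSeries.ofScalars A c with hS
  have hrad : q.radius ≤ S.radius := by
    apply FormalMultilinearSeries.radius_le_of_le
    intro n
    rw [FormalMultilinearSeries.ofScalars_norm, hc, ← FormalMultilinearSeries.norm_apply_eq_norm_coef]
  have hpos : 0 < S.radius := lt_of_lt_of_le hq.r_pos (hq.r_le.trans hrad)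
  have hSb := S.hasFPowerSeriesOnBall hpos
  -- choose ε
  have hcont : Tendsto (fun ε : ℂ => opM ε (0, 0)) (𝓝 0) (𝓝 0) := by
    have : Continuous (fun ε : ℂ => opM ε (0, 0)) := by unfold opM; fun_prop
    have h0 := this.tendsto 0
    rwa [opM_zero] at h0
  have hev : ∀ᶠ ε : ℂ in 𝓝[≠] 0, opM ε (0, 0) ∈ Metric.eball (0 : A) S.radius :=
    (hcont.mono_left nhdsWithin_le_nhds) (Metric.eball_mem_nhds _ hpos)
  obtain ⟨ε, hε, hε0⟩ := (hev.and self_mem_nhdsWithin).exists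
  refine ⟨ε, hε0, fun p => (S.sum (opM ε p) (0, 1)).1, ?_, ?_⟩
  · have h1 : AnalyticAt ℂ S.sum (opM ε (0, 0)) := hSb.analyticAt_of_mem hε
    have h2 : AnalyticAt ℂ (fun p => S.sum (opM ε p)) (0, 0) := h1.comp (opM_analytic ε (0, 0))
    let L : A →L[ℂ] ℂ := (ContinuousLinearMap.fst ℂ ℂ ℂ).comp
      (ContinuousLinearMap.apply ℂ (ℂ × ℂ) ((0, 1) : ℂ × ℂ))
    exact (L.analyticAt _).comp h2
  · have e1 : ∀ᶠ p in 𝓝 ((0, 0) : ℂ × ℂ), opM ε p ∈ Metric.eball (0 : A) S.radius :=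
      (opM_analytic ε (0, 0)).continuousAt.eventually_mem (Metric.isOpen_eball.mem_nhds hε)
    have e2 : ∀ᶠ p in 𝓝 ((0, 0) : ℂ × ℂ), p.1 ∈ Metric.eball (0 : ℂ) r :=
      continuousAt_fst.eventually_mem (Metric.eball_mem_nhds _ hq.r_pos)
    have e3 : ∀ᶠ p in 𝓝 ((0, 0) : ℂ × ℂ), p.1 + p.2 ∈ Metric.eball (0 : ℂ) r := by
      have : ContinuousAt (fun p : ℂ × ℂ => p.1 + p.2) (0, 0) := by fun_prop
      exact this.eventually_mem (by simpa using Metric.eball_mem_nhds (0:ℂ) hq.r_pos)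
    filter_upwards [e1, e2, e3] with p h1 h2 h3
    have s1 := hSb.hasSum h1
    have s2 := hq.hasSum h2
    have s3 := hq.hasSum h3
    let L : A →L[ℂ] ℂ := (ContinuousLinearMap.fst ℂ ℂ ℂ).comp
      (ContinuousLinearMap.apply ℂ (ℂ × ℂ) ((0, 1) : ℂ × ℂ))
    have s4 := (L.hasSum s1).mul_left p.2
    have s5 := (s3.sub s2).mul_left ε
    rw [add_assoc]
    rw [zero_add] at s4
    refine s4.unique ?_
    convert s5 using 1
    funext n
    have := (opM_pow ε p n).2
    simp only [hS, FormalMultilinearSeries.ofScalars_apply_eq, FormalMultilinearSeries.apply_eq_pow_smul_coeff, ← hc]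
    have hap : ∀ T : A, L T = (T (0, 1)).1 := fun T => rfl
    rw [map_smul, hap]
    simp only [smul_eq_mul]
    linear_combination c n * this

lemma Qf_analyticAt (φ : ℂ → ℂ) (p : ℂ × ℂ) (h1 : AnalyticAt ℂ φ p.1)
    (h2 : AnalyticAt ℂ φ (p.1 + p.2)) : AnalyticAt ℂ (Qf φ) p := by
  obtain ⟨a, k⟩ := p
  by_cases hk : k = 0
  · subst hk
    obtain ⟨ε, hε, G, hG, hGe⟩ := exists_G φ a h1
    have hcomp : AnalyticAt ℂ (fun p : ℂ × ℂ => ε⁻¹ * G (p.1 - a, p.2)) (a, 0) := by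
      refine analyticAt_const.mul ?_
      have hm : AnalyticAt ℂ (fun p : ℂ × ℂ => ((p.1 - a, p.2) : ℂ × ℂ)) (a, 0) :=
        (analyticAt_fst.sub analyticAt_const).prod analyticAt_snd
      have hG' : AnalyticAt ℂ G ((fun p : ℂ × ℂ => ((p.1 - a, p.2) : ℂ × ℂ)) (a, 0)) := by simpa using hG
      exact AnalyticAt.fun_comp (g := G) (f := fun p : ℂ × ℂ => ((p.1 - a, p.2) : ℂ × ℂ)) hG' hm
    refine hcomp.congr ?_
    have hsh : Tendsto (fun p : ℂ × ℂ => ((p.1 - a, p.2) : ℂ × ℂ)) (𝓝 (a, 0)) (𝓝 (0, 0)) := by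
      have : Continuous (fun p : ℂ × ℂ => ((p.1 - a, p.2) : ℂ × ℂ)) := by fun_prop
      simpa using this.tendsto (a, 0)
    have e0 := hsh.eventually hGe
    have e1 := hcomp.eventually_analyticAt
    have e2 : ∀ᶠ p : ℂ × ℂ in 𝓝 (a, 0), AnalyticAt ℂ φ p.1 :=
      (continuousAt_fst (p := (a, (0:ℂ)))).eventually h1.eventually_analyticAt
    filter_upwards [e0.eventually_nhds, e1, e2] with p h0 h1' h2'
    have key : ∀ᶠ q in 𝓝 p, q.2 ≠ 0 → ε⁻¹ * G (q.1 - a, q.2) = Qf φ q := by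
      filter_upwards [h0] with q hq hq0
      have := Qf_mul φ q.1 q.2
      apply mul_left_cancel₀ hq0
      rw [this]
      simp only [add_sub_cancel] at hq
      field_simp
      linear_combination hq
    by_cases hp : p.2 = 0
    · obtain ⟨x, y⟩ := p
      simp only at hp
      subst hp
      have hline : Tendsto (fun t : ℂ => ((x, t) : ℂ × ℂ)) (𝓝 0) (𝓝 (x, 0)) := by
        have : Continuous (fun t : ℂ => ((x, t) : ℂ × ℂ)) := by fun_prop
        exact this.tendsto 0
      have t1 : Tendsto (fun t : ℂ => ε⁻¹ * G (x - a, t)) (𝓝[≠] 0) (𝓝 (ε⁻¹ * G (x - a, 0))) :=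
        (h1'.continuousAt.tendsto.comp hline).mono_left nhdsWithin_le_nhds
      have t2 : Tendsto (fun t : ℂ => Qf φ (x, t)) (𝓝[≠] 0) (𝓝 (Qf φ (x, 0))) := by
        have hc : ContinuousAt (dslope φ x) x := continuousAt_dslope_same.2 h2'.differentiableAt
        have hs : Tendsto (fun t : ℂ => x + t) (𝓝 0) (𝓝 x) := by
          have : Continuous (fun t : ℂ => x + t) := by fun_prop
          simpa using this.tendsto 0
        have := (hc.tendsto.comp hs).mono_left (nhdsWithin_le_nhds (s := {0}ᶜ))
        simpa [Qf, Function.comp_def] using this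
      refine tendsto_nhds_unique t1 (t2.congr' ?_)
      filter_upwards [nhdsWithin_le_nhds (hline.eventually key), self_mem_nhdsWithin] with t ht ht0
      exact (ht ht0).symm
    · exact key.self_of_nhds hp
  · have h2' : AnalyticAt ℂ (fun p : ℂ × ℂ => (φ (p.1 + p.2) - φ p.1) / p.2) (a, k) := by
      refine AnalyticAt.div (AnalyticAt.sub ?_ ?_) analyticAt_snd hk
      · exact AnalyticAt.fun_comp (g := φ) (f := fun p : ℂ × ℂ => p.1 + p.2) h2 (analyticAt_fst.add analyticAt_snd)
      · exact AnalyticAt.fun_comp (g := φ) (f := fun p : ℂ × ℂ => p.1) h1 analyticAt_fst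
    refine h2'.congr ?_
    have : ∀ᶠ p : ℂ × ℂ in 𝓝 (a, k), p.2 ≠ 0 :=
      (continuousAt_snd (p := (a, k))).eventually_ne hk
    filter_upwards [this] with p hp
    rw [← Qf_mul φ p.1 p.2]
    field_simp

lemma strip_isOpen (a : ℝ) : IsOpen (strip a) :=
  isOpen_lt (by fun_prop) continuous_const

lemma strip_convex (a : ℝ) : Convex ℝ (strip a) := by
  have : strip a = Complex.imLm ⁻¹' (Set.Ioo (-a) a) := by
    ext z; simp [strip, abs_lt]
  rw [this]
  exact (convex_Ioo (-a) a).is_linear_preimage Complex.imLm.isLinear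

lemma strip_add_real {a : ℝ} {z : ℂ} (hz : z ∈ strip a) (t : ℝ) : z + t ∈ strip a := by
  simpa [strip] using hz

lemma Per1.deriv {u : ℂ → ℂ} (h : Per1 u) : Per1 (deriv u) := by
  intro z
  have h1 : (fun w => u (w + 1)) = u := funext h
  rw [← deriv_comp_add_const, h1]

lemma norm_le_of_fw (u : ℂ → ℂ) (hper : Per1 u) (hana : AnalyticOnNhd ℂ u (strip 1))
    (hn : fwNormLE u 1) : ∀ z ∈ strip 1, ‖u z‖ ≤ 1 := by
  obtain ⟨hs, hle⟩ := hn
  set v : ℂ → ℂ := fun z => ∑' k : ℤ, fcoeff u k * Complex.exp (2 * π * Complex.I * k * z) with hv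
  have hbd : ∀ (k : ℤ) (z : ℂ), z ∈ strip 1 →
      ‖fcoeff u k * Complex.exp (2 * π * Complex.I * k * z)‖ ≤
        ‖fcoeff u k‖ * Real.exp (2 * π * |(k : ℝ)|) := by
    intro k z hz
    rw [norm_mul, Complex.norm_exp]
    refine mul_le_mul_of_nonneg_left ?_ (norm_nonneg _)
    rw [Real.exp_le_exp]
    have : (2 * π * Complex.I * k * z).re = 2 * π * (-(k * z.im)) := by
      simp
      ring
    rw [this]
    refine mul_le_mul_of_nonneg_left ?_ (by positivity)
    have hz' : |z.im| < 1 := hz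
    calc -((k:ℝ) * z.im) ≤ |(k:ℝ) * z.im| := neg_le_abs _
      _ = |(k:ℝ)| * |z.im| := abs_mul _ _
      _ ≤ |(k:ℝ)| * 1 := by gcongr
      _ = _ := mul_one _
  have hvd : DifferentiableOn ℂ v (strip 1) := by
    refine Complex.differentiableOn_tsum_of_summable_norm hs (fun k => ?_) (strip_isOpen 1) hbd
    fun_prop
  have hva : AnalyticOnNhd ℂ v (strip 1) := hvd.analyticOnNhd (strip_isOpen 1)
  have hreal : ∀ t : ℝ, u t = v t := by
    have : Fact (0 < (1:ℝ)) := ⟨one_pos⟩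
    have hmem : ∀ t : ℝ, (t : ℂ) ∈ strip 1 := by intro t; simp [strip]
    have hP : Function.Periodic (fun t : ℝ => u t) 1 := by
      intro t; simpa using hper t
    have hcont : Continuous (fun t : ℝ => u t) := by
      rw [continuous_iff_continuousAt]
      intro t
      exact ContinuousAt.comp (g := u) (hana _ (hmem t)).continuousAt Complex.continuous_ofReal.continuousAt
    let F : C(AddCircle (1:ℝ), ℂ) := ⟨hP.lift, by
      exact continuous_coinduced_dom.mpr hcont⟩
    have hF : ∀ t : ℝ, F (t : AddCircle (1:ℝ)) = u t := fun t => hP.lift_coe t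
    have hco : ∀ k, fourierCoeff F k = fcoeff u k := by
      intro k
      rw [fourierCoeff_eq_intervalIntegral _ _ 0]
      simp only [hF, fcoeff, fourier_coe_apply]
      simp only [div_one, one_smul, zero_add, smul_eq_mul]
      congr 1
      funext t
      rw [mul_comm]
      congr 2
      push_cast
      ring
    have hsum : Summable (fourierCoeff F) := by
      refine Summable.of_norm_bounded hs (fun k => ?_)
      rw [hco]
      refine le_mul_of_one_le_right (norm_nonneg _) ?_
      exact Real.one_le_exp (by positivity)
    intro t
    have := has_pointwise_sum_fourier_series_of_summable hsum (t : AddCircle (1:ℝ))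
    rw [hF] at this
    rw [← this.tsum_eq, hv]
    refine tsum_congr (fun k => ?_)
    rw [hco, fourier_coe_apply, smul_eq_mul]
    simp
  have heq : EqOn u v (strip 1) := by
    have h0 : (0:ℂ) ∈ strip 1 := by simp [strip]
    refine hana.eqOn_of_preconnected_of_frequently_eq hva (strip_convex 1).isPreconnected h0 ?_
    have ht : Tendsto (fun t : ℝ => (t : ℂ)) (𝓝[≠] 0) (𝓝[≠] 0) := by
      refine tendsto_nhdsWithin_iff.2 ⟨?_, ?_⟩
      · have := Complex.continuous_ofReal.tendsto 0
        simpa using this.mono_left nhdsWithin_le_nhds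
      · filter_upwards [self_mem_nhdsWithin] with t ht
        simpa using ht
    refine ht.frequently (Eventually.frequently (Eventually.of_forall hreal))
  intro z hz
  rw [heq hz]
  refine (tsum_of_norm_bounded hs.hasSum (fun k => hbd k z hz)).trans hle

lemma deriv_bound (u : ℂ → ℂ) (hper : Per1 u) (hana : AnalyticOnNhd ℂ u (strip 1)) (C : ℝ)
    (hC : ∀ z ∈ strip 1, ‖deriv (deriv u) z‖ ≤ C) : ∀ z ∈ strip 1, ‖deriv u z‖ ≤ C / 2 := by
  intro z hz
  have hC0 : 0 ≤ C := (norm_nonneg _).trans (hC z hz)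
  have hd := hana.deriv
  have hder : ∀ t : ℝ, HasDerivAt (fun t : ℝ => u (z + t)) (deriv u (z + t)) t := by
    intro t
    have h1 := (hana _ (strip_add_real hz t)).differentiableAt.hasDerivAt
    exact (h1.comp_const_add z (t : ℂ)).comp_ofReal
  have hcont : Continuous (fun t : ℝ => deriv u (z + t)) := by
    rw [continuous_iff_continuousAt]
    intro t
    exact ContinuousAt.comp (g := deriv u) (f := fun t : ℝ => z + (t : ℂ))
      (hd _ (strip_add_real hz t)).continuousAt (by fun_prop)
  have hint : ∫ t in (-(1/2) : ℝ)..(1/2), deriv u (z + t) = 0 := by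
    rw [intervalIntegral.integral_eq_sub_of_hasDerivAt (fun t _ => hder t)
      (hcont.intervalIntegrable _ _)]
    have := hper (z + ((-(1/2) : ℝ) : ℂ))
    rw [← this, sub_eq_zero]
    congr 1
    push_cast
    ring
  have hi2 : ∫ t in (-(1/2) : ℝ)..(1/2), (deriv u z - deriv u (z + t)) = deriv u z := by
    rw [intervalIntegral.integral_sub (by simp) (hcont.intervalIntegrable _ _), hint]
    simp
    norm_num
  rw [← hi2]
  have := intervalIntegral.norm_integral_le_of_norm_le_const (a := (-(1/2) : ℝ)) (b := 1/2)
    (f := fun t : ℝ => deriv u z - deriv u (z + t)) (C := C / 2) (by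
      intro t ht
      rw [uIoc_of_le (by norm_num)] at ht
      have h1 := (strip_convex 1).norm_image_sub_le_of_norm_deriv_le (f := deriv u) (C := C)
        (fun x hx => (hd x hx).differentiableAt) hC (strip_add_real hz t) hz
      refine h1.trans ?_
      have : ‖z - (z + (t:ℂ))‖ = |t| := by simp
      rw [this]
      have : |t| ≤ 1/2 := abs_le.2 ⟨ht.1.le, ht.2⟩
      nlinarith)
  refine this.trans (le_of_eq ?_)
  norm_num

lemma phi_deriv_bound (φ : ℂ → ℂ) (hper : Per1 φ) (hana : AnalyticOnNhd ℂ φ (strip 1))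
    (hnorm : fwNormLE (deriv^[3] φ) 1) : ∀ z ∈ strip 1, ‖deriv φ z‖ ≤ 1 / 4 := by
  have h3 := norm_le_of_fw (deriv^[3] φ) (hper.deriv.deriv.deriv) hana.deriv.deriv.deriv hnorm
  have h2 := deriv_bound (deriv φ) hper.deriv hana.deriv 1 h3
  have h1 := deriv_bound φ hper hana (1/2) h2
  intro z hz
  refine (h1 z hz).trans (by norm_num)

section Main
variable {φ : ℂ → ℂ} {M : ℝ}

def Bf (φ : ℂ → ℂ) (a y e : ℂ) : ℂ := e * Qf φ (a, y * e)

lemma Bf_mul (a y e : ℂ) : y * Bf φ a y e = φ (a + y * e) - φ a := by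
  rw [← Qf_mul, Bf]; ring

lemma Bf_zero_left (a e : ℂ) : Bf φ a 0 e = e * deriv φ a := by
  simp [Bf, Qf]

lemma Bf_zero_right (a y : ℂ) : Bf φ a y 0 = 0 := by simp [Bf]

lemma mem_strip_add {a k : ℂ} (h : |a.im| + ‖k‖ < 1) : a + k ∈ strip 1 := by
  have h1 := Complex.abs_im_le_norm k
  have h2 := abs_add_le a.im k.im
  simp only [strip, mem_ofPred_eq, Complex.add_im]
  linarith

lemma Bf_lip (hana : AnalyticOnNhd ℂ φ (strip 1)) (hM : ∀ z ∈ strip 1, ‖deriv φ z‖ ≤ M)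
    {a y e₁ e₂ : ℂ} (h1 : |a.im| + ‖y * e₁‖ < 1) (h2 : |a.im| + ‖y * e₂‖ < 1) :
    ‖Bf φ a y e₁ - Bf φ a y e₂‖ ≤ M * ‖e₁ - e₂‖ := by
  by_cases hy : y = 0
  · subst hy
    have ha : a ∈ strip 1 := by simpa [strip] using h1
    rw [Bf_zero_left, Bf_zero_left, ← sub_mul, norm_mul, mul_comm]
    exact mul_le_mul_of_nonneg_right (hM a ha) (norm_nonneg _)
  · have hy' : 0 < ‖y‖ := norm_pos_iff.2 hy
    have h := (strip_convex 1).norm_image_sub_le_of_norm_deriv_le (f := φ) (C := M)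
        (fun x hx => (hana x hx).differentiableAt) hM (mem_strip_add h2) (mem_strip_add h1)
    have e1 : φ (a + y * e₁) - φ (a + y * e₂) = y * (Bf φ a y e₁ - Bf φ a y e₂) := by
      rw [mul_sub, Bf_mul, Bf_mul]; ring
    have e2 : a + y * e₁ - (a + y * e₂) = y * (e₁ - e₂) := by ring
    rw [e1, e2, norm_mul, norm_mul] at h
    have : ‖y‖ * ‖Bf φ a y e₁ - Bf φ a y e₂‖ ≤ ‖y‖ * (M * ‖e₁ - e₂‖) := by linarith
    exact le_of_mul_le_mul_left this hy'

lemma Bf_bound (hana : AnalyticOnNhd ℂ φ (strip 1)) (hM : ∀ z ∈ strip 1, ‖deriv φ z‖ ≤ M)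
    {a y e : ℂ} (h1 : |a.im| + ‖y * e‖ < 1) : ‖Bf φ a y e‖ ≤ M * ‖e‖ := by
  have h2 : |a.im| + ‖y * 0‖ < 1 := by
    have := norm_nonneg (y * e)
    simp; linarith
  simpa [Bf_zero_right] using Bf_lip hana hM h1 h2

lemma Bf_hasDerivAt (hana : AnalyticOnNhd ℂ φ (strip 1)) {a y e : ℂ}
    (h1 : |a.im| + ‖y * e‖ < 1) :
    HasDerivAt (fun e => Bf φ a y e) (deriv φ (a + y * e)) e := by
  by_cases hy : y = 0
  · subst hy
    simp only [Bf_zero_left, zero_mul, add_zero]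
    simpa using (hasDerivAt_id e).mul_const (deriv φ a)
  · have hfun : (fun e => Bf φ a y e) = fun e => (φ (a + y * e) - φ a) / y := by
      funext e; rw [← Bf_mul]; field_simp
    rw [hfun]
    have hd := (hana _ (mem_strip_add h1)).differentiableAt.hasDerivAt
    have hl : HasDerivAt (fun e : ℂ => a + y * e) y e := by
      simpa using ((hasDerivAt_id e).const_mul y).const_add a
    have := ((hd.comp e hl).sub_const (φ a)).div_const y
    rw [mul_div_assoc, div_self hy, mul_one] at this
    exact this

/-- The defining predicate of `1 + f̄`. -/
def Sol (ω : ℝ) (φ : ℂ → ℂ) (p : ℂ × ℂ) (e : ℂ) : Prop :=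
  |p.1.im| + ‖p.2 * e‖ < 1 ∧ e = 1 / (1 + deriv φ p.1) - Bf φ (p.1 + ω) p.2 e

def solE (ω : ℝ) (φ : ℂ → ℂ) (p : ℂ × ℂ) : ℂ := Classical.epsilon (Sol ω φ p)

lemma Qf_per (hper : Per1 φ) (a k : ℂ) : Qf φ (a + 1, k) = Qf φ (a, k) := by
  by_cases hk : k = 0
  · subst hk
    simp [Qf, hper.deriv a]
  · apply mul_left_cancel₀ hk
    rw [Qf_mul, Qf_mul, hper a, ← hper (a + k)]
    congr 2; ring

lemma Sol_per (ω : ℝ) (hper : Per1 φ) (z w : ℂ) : Sol ω φ (z + 1, w) = Sol ω φ (z, w) := by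
  funext e
  have h : z + 1 + (ω : ℂ) = z + ω + 1 := by ring
  simp only [Sol, hper.deriv z, h, Bf, Qf_per hper]
  simp

lemma solE_per (ω : ℝ) (hper : Per1 φ) : Per1' (solE ω φ) := by
  intro z w
  simp only [solE, Sol_per ω hper]

lemma im_shift (x : ℂ) (ω : ℝ) : (x + (ω : ℂ)).im = x.im := by simp

lemma one_add_ne (hM1 : M < 1) {d : ℂ} (h : ‖d‖ ≤ M) : 1 + d ≠ 0 ∧ 1 - M ≤ ‖1 + d‖ := by
  have h1 : 1 - M ≤ ‖1 + d‖ := by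
    have := norm_sub_norm_le (1 : ℂ) (-d)
    simp at this
    linarith
  refine ⟨fun h0 => ?_, h1⟩
  rw [h0, norm_zero] at h1
  linarith

lemma Sol_mem {ω : ℝ} {p : ℂ × ℂ} {e : ℂ} (h : Sol ω φ p e) : p.1 ∈ strip 1 := by
  have := h.1
  have := norm_nonneg (p.2 * e)
  simp only [strip, mem_ofPred_eq]
  linarith

lemma Sol_unique (hana : AnalyticOnNhd ℂ φ (strip 1)) (hM : ∀ z ∈ strip 1, ‖deriv φ z‖ ≤ M)
    (hM1 : M < 1) {ω : ℝ} {p : ℂ × ℂ} {e₁ e₂ : ℂ} (h1 : Sol ω φ p e₁) (h2 : Sol ω φ p e₂) :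
    e₁ = e₂ := by
  have h := Bf_lip hana hM (a := p.1 + ω) (by rw [im_shift]; exact h1.1)
    (by rw [im_shift]; exact h2.1)
  have he : e₁ - e₂ = -(Bf φ (p.1 + ω) p.2 e₁ - Bf φ (p.1 + ω) p.2 e₂) := by
    linear_combination h1.2 - h2.2
  have hn : ‖e₁ - e₂‖ ≤ M * ‖e₁ - e₂‖ := by
    conv_lhs => rw [he, norm_neg]
    exact h
  by_contra hne
  have : 0 < ‖e₁ - e₂‖ := norm_pos_iff.2 (sub_ne_zero.2 hne)
  nlinarith

lemma inv_bound (hM1 : M < 1) {d : ℂ} (h : ‖d‖ ≤ M) : ‖1 / (1 + d)‖ ≤ 1 / (1 - M) := by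
  rw [norm_div, norm_one]
  exact one_div_le_one_div_of_le (by linarith) (one_add_ne hM1 h).2

lemma Sol_bound (hana : AnalyticOnNhd ℂ φ (strip 1)) (hM : ∀ z ∈ strip 1, ‖deriv φ z‖ ≤ M)
    (hM1 : M < 1) {ω : ℝ} {p : ℂ × ℂ} {e : ℂ} (h : Sol ω φ p e) :
    ‖e‖ ≤ 1 / (1 - M) ^ 2 := by
  have hb := Bf_bound hana hM (a := p.1 + ω) (by rw [im_shift]; exact h.1)
  have hi := inv_bound hM1 (hM _ (Sol_mem h))
  have h3 : ‖e‖ ≤ ‖1 / (1 + deriv φ p.1)‖ + ‖Bf φ (p.1 + ω) p.2 e‖ := by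
    conv_lhs => rw [h.2]
    exact norm_sub_le _ _
  have h1 : 0 < 1 - M := by linarith
  have h4 : (1 - M) * ‖e‖ ≤ 1 / (1 - M) := by linarith
  rw [le_div_iff₀ h1] at h4
  rw [le_div_iff₀ (by positivity)]
  linarith

lemma Sol_exists (hana : AnalyticOnNhd ℂ φ (strip 1)) (hM : ∀ z ∈ strip 1, ‖deriv φ z‖ ≤ M)
    (hM0 : 0 ≤ M) (hM1 : M < 1) (ω : ℝ) {p : ℂ × ℂ} (hp : p ∈ Dtri ((1 - M) ^ 2)) :
    ∃ e, Sol ω φ p e := by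
  have h1 : 0 < 1 - M := by linarith
  have hp' : |p.1.im| + ‖p.2‖ / (1 - M) ^ 2 < 1 := hp
  have hx : p.1 ∈ strip 1 := by
    have : 0 ≤ ‖p.2‖ / (1 - M) ^ 2 := by positivity
    simp only [strip, mem_ofPred_eq]
    linarith
  set R : ℝ := 1 / (1 - M) ^ 2 with hR
  have hR0 : 0 ≤ R := by positivity
  have hball : ∀ e : ℂ, ‖e‖ ≤ R → |p.1.im| + ‖p.2 * e‖ < 1 := by
    intro e he
    have : ‖p.2 * e‖ ≤ ‖p.2‖ / (1 - M) ^ 2 := by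
      rw [norm_mul, div_eq_mul_one_div]
      exact mul_le_mul_of_nonneg_left he (norm_nonneg _)
    linarith
  set T : ℂ → ℂ := fun e => 1 / (1 + deriv φ p.1) - Bf φ (p.1 + ω) p.2 e with hT
  have hmaps : MapsTo T (Metric.closedBall 0 R) (Metric.closedBall 0 R) := by
    intro e he
    rw [mem_closedBall_zero_iff] at he ⊢
    have hb := Bf_bound hana hM (a := p.1 + ω) (y := p.2) (e := e)
      (by rw [im_shift]; exact hball e he)
    have hi := inv_bound hM1 (hM _ hx)
    calc ‖T e‖ ≤ ‖1 / (1 + deriv φ p.1)‖ + ‖Bf φ (p.1 + ω) p.2 e‖ := norm_sub_le _ _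
      _ ≤ 1 / (1 - M) + M * R := by nlinarith
      _ = R := by rw [hR]; field_simp; ring
  have hcontr : ContractingWith ⟨M, hM0⟩ (hmaps.restrict T _ _) := by
    refine ⟨by exact_mod_cast hM1, LipschitzWith.of_dist_le_mul ?_⟩
    rintro ⟨e₁, h₁⟩ ⟨e₂, h₂⟩
    rw [mem_closedBall_zero_iff] at h₁ h₂
    have := Bf_lip hana hM (a := p.1 + ω) (by rw [im_shift]; exact hball e₂ h₂)
      (by rw [im_shift]; exact hball e₁ h₁)
    rw [Subtype.dist_eq, Subtype.dist_eq, dist_eq_norm, dist_eq_norm]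
    have hT2 : T e₁ - T e₂ = Bf φ (p.1 + ω) p.2 e₂ - Bf φ (p.1 + ω) p.2 e₁ := by
      simp only [hT]; ring
    change ‖T e₁ - T e₂‖ ≤ M * ‖e₁ - e₂‖
    rw [hT2, norm_sub_rev e₁]
    exact this
  obtain ⟨e, he, hfix, -⟩ := hcontr.exists_fixedPoint' Metric.isClosed_closedBall.isComplete hmaps
    (Metric.mem_closedBall_self hR0) (edist_ne_top _ _)
  rw [mem_closedBall_zero_iff] at he
  exact ⟨e, hball e he, hfix.symm⟩

lemma deriv_comp_analytic (hana : AnalyticOnNhd ℂ φ (strip 1)) {E : Type*}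
    [NormedAddCommGroup E] [NormedSpace ℂ E] {f : E → ℂ} {x : E} (hf : AnalyticAt ℂ f x)
    (hx : f x ∈ strip 1) : AnalyticAt ℂ (fun p => deriv φ (f p)) x :=
  AnalyticAt.fun_comp (g := deriv φ) (f := f) (hana.deriv _ hx) hf

lemma Qf_comp_analytic (hana : AnalyticOnNhd ℂ φ (strip 1)) {E : Type*}
    [NormedAddCommGroup E] [NormedSpace ℂ E] {f g : E → ℂ} {x : E} (hf : AnalyticAt ℂ f x)
    (hg : AnalyticAt ℂ g x) (hx : |(f x).im| + ‖g x‖ < 1) :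
    AnalyticAt ℂ (fun p => Qf φ (f p, g p)) x := by
  have h1 : f x ∈ strip 1 := by
    have := norm_nonneg (g x)
    simp only [strip, mem_ofPred_eq]
    linarith
  exact AnalyticAt.fun_comp (g := Qf φ) (f := fun p => (f p, g p))
    (Qf_analyticAt φ _ (hana _ h1) (hana _ (mem_strip_add hx))) (hf.prod hg)

lemma solE_analyticAt (hana : AnalyticOnNhd ℂ φ (strip 1))
    (hM : ∀ z ∈ strip 1, ‖deriv φ z‖ ≤ M) (hM1 : M < 1) {ω : ℝ} {p : ℂ × ℂ} {e : ℂ}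
    (h : Sol ω φ p e) : AnalyticAt ℂ (solE ω φ) p := by
  set F : (ℂ × ℂ) × ℂ → ℂ := fun q =>
    q.2 + Bf φ (q.1.1 + ω) q.1.2 q.2 - 1 / (1 + deriv φ q.1.1) with hF
  have hsh : |(p.1 + (ω : ℂ)).im| + ‖p.2 * e‖ < 1 := by rw [im_shift]; exact h.1
  have hFa : AnalyticAt ℂ F (p, e) := by
    have a1 : AnalyticAt ℂ (fun q : (ℂ × ℂ) × ℂ => q.1.1) (p, e) :=
      analyticAt_fst.fun_comp analyticAt_fst
    have a2 : AnalyticAt ℂ (fun q : (ℂ × ℂ) × ℂ => q.1.2) (p, e) :=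
      analyticAt_snd.fun_comp analyticAt_fst
    have a3 : AnalyticAt ℂ (fun q : (ℂ × ℂ) × ℂ => q.2) (p, e) := analyticAt_snd
    refine (a3.add (a3.mul ?_)).sub (analyticAt_const.div (analyticAt_const.add ?_) ?_)
    · exact Qf_comp_analytic hana (a1.add analyticAt_const) (a2.mul a3) hsh
    · exact deriv_comp_analytic hana a1 (Sol_mem h)
    · exact (one_add_ne hM1 (hM _ (Sol_mem h))).1
  have hF0 : F (p, e) = 0 := by
    simp only [hF]
    linear_combination h.2
  have hcd : ContDiffAt ℂ ⊤ F (p, e) := hFa.contDiffAt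
  have hd : HasDerivAt (fun e => F (p, e)) (1 + deriv φ (p.1 + ω + p.2 * e)) e :=
    ((hasDerivAt_id' e).fun_add (Bf_hasDerivAt hana hsh)).sub_const (1 / (1 + deriv φ p.1))
  have hne := (one_add_ne hM1 (hM _ (mem_strip_add hsh))).1
  have hinv : (fderiv ℂ F (p, e) ∘L .inr ℂ (ℂ × ℂ) ℂ).IsInvertible := by
    refine ⟨ContinuousLinearEquiv.unitsEquivAut ℂ (Units.mk0 _ hne), ?_⟩
    have h2 : HasFDerivAt (fun e => F (p, e)) (fderiv ℂ F (p, e) ∘L .inr ℂ (ℂ × ℂ) ℂ) e := by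
      have hl : HasFDerivAt (fun e : ℂ => (p, e)) (ContinuousLinearMap.inr ℂ (ℂ × ℂ) ℂ) e :=
        hasFDerivAt_prodMk_right p e
      exact hFa.differentiableAt.hasFDerivAt.comp e hl
    rw [h2.unique hd.hasFDerivAt]
    ext
    simp
  set ψ := hcd.implicitFunction (by simp) hinv with hψ
  have hψa : AnalyticAt ℂ ψ p :=
    (hcd.contDiffAt_implicitFunction (by simp) hinv).analyticAt
  have hψ0 : ψ p = e := hcd.implicitFunction_apply_self (by simp) hinv
  have hev : ∀ᶠ q in 𝓝 p, F (q, ψ q) = F (p, e) :=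
    hcd.eventually_apply_implicitFunction (by simp) hinv
  refine hψa.congr ?_
  have hopen : ∀ᶠ q in 𝓝 p, |q.1.im| + ‖q.2 * ψ q‖ < 1 := by
    have hψc := hψa.continuousAt
    have hc : ContinuousAt (fun q : ℂ × ℂ => |q.1.im| + ‖q.2 * ψ q‖) p := by
      refine ContinuousAt.add (by fun_prop) ?_
      exact (continuousAt_snd.mul hψc).norm
    exact hc.eventually_lt continuousAt_const (by simpa [hψ0] using h.1)
  filter_upwards [hev, hopen] with q h1 h2
  have hS : Sol ω φ q (ψ q) := by
    refine ⟨h2, ?_⟩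
    rw [hF0] at h1
    simp only [hF] at h1
    linear_combination h1
  exact Sol_unique hana hM hM1 hS (Classical.epsilon_spec ⟨_, hS⟩)

lemma triSup_le {lam c : ℝ} {u : ℂ × ℂ → ℂ} (h : ∀ p ∈ Dtri lam, ‖u p‖ ≤ c) :
    triSup lam u ≤ ENNReal.ofReal c := by
  refine iSup₂_le fun p hp => ?_
  rw [← ENNReal.ofReal_coe_nnreal]
  exact ENNReal.ofReal_le_ofReal (h p hp)

lemma main_aux (ω : ℝ) (hper : Per1 φ) (hana : AnalyticOnNhd ℂ φ (strip 1))
    (hM : ∀ z ∈ strip 1, ‖deriv φ z‖ ≤ M) (hM0 : 0 ≤ M) (hM1 : M < 1) :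
    ∃ fb gb : ℂ × ℂ → ℂ,
      Per1' fb ∧ Per1' gb ∧
      AnalyticOnNhd ℂ fb (Dtri ((1 - M) ^ 2)) ∧
      AnalyticOnNhd ℂ gb (Dtri ((1 - M) ^ 2)) ∧
      (∀ p ∈ Dtri ((1 - M) ^ 2),
        p.2 + p.2 * fb p =
          p.2 / (1 + deriv φ p.1) + φ (p.1 + (ω : ℂ)) -
            φ (p.1 + (ω : ℂ) + p.2 + p.2 * fb p) ∧
        p.2 + p.2 * gb p =
          (p.2 + p.2 * fb p + φ (p.1 + p.2 + p.2 * fb p) - φ p.1) *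
            (1 + deriv φ (p.1 + (ω : ℂ) + p.2 + p.2 * fb p))) ∧
      triSup ((1 - M) ^ 2) fb ≤ ENNReal.ofReal (M * (2 - M) / (1 - M) ^ 2) ∧
      triSup ((1 - M) ^ 2) (fun p => 1 + fb p) ≤ ENNReal.ofReal (1 / (1 - M) ^ 2) ∧
      triSup ((1 - M) ^ 2) gb ≤ ENNReal.ofReal (2 * M * (2 + M) / (1 - M) ^ 2) := by
  have h1M : 0 < 1 - M := by linarith
  have hsol : ∀ p ∈ Dtri ((1 - M) ^ 2), Sol ω φ p (solE ω φ p) := fun p hp =>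
    Classical.epsilon_spec (Sol_exists hana hM hM0 hM1 ω hp)
  have hea : ∀ p ∈ Dtri ((1 - M) ^ 2), AnalyticAt ℂ (solE ω φ) p := fun p hp =>
    solE_analyticAt hana hM hM1 (hsol p hp)
  have hfb : ∀ p ∈ Dtri ((1 - M) ^ 2), ‖solE ω φ p - 1‖ ≤ M * (2 - M) / (1 - M) ^ 2 := by
    intro p hp
    have hs := hsol p hp
    have hx := Sol_mem hs
    have hb := Bf_bound hana hM (a := p.1 + ω) (by rw [im_shift]; exact hs.1)
    have he := Sol_bound hana hM hM1 hs
    have hi := inv_bound hM1 (hM _ hx)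
    have hd := hM _ hx
    have hne := (one_add_ne hM1 hd).1
    have heq : solE ω φ p - 1 = -(deriv φ p.1 * (1 / (1 + deriv φ p.1))) -
        Bf φ (p.1 + ω) p.2 (solE ω φ p) := by
      have h2 := hs.2
      have h3 : 1 / (1 + deriv φ p.1) - 1 = -(deriv φ p.1 * (1 / (1 + deriv φ p.1))) := by
        field_simp; ring
      linear_combination h2 + h3
    rw [heq]
    calc _ ≤ ‖deriv φ p.1‖ * ‖1 / (1 + deriv φ p.1)‖ + ‖Bf φ (p.1 + ω) p.2 (solE ω φ p)‖ := by
          refine (norm_sub_le _ _).trans ?_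
          rw [norm_neg, norm_mul]
      _ ≤ M * (1 / (1 - M)) + M * (1 / (1 - M) ^ 2) := by
          refine add_le_add (mul_le_mul hd hi (norm_nonneg _) hM0) (hb.trans ?_)
          exact mul_le_mul_of_nonneg_left he hM0
      _ = _ := by field_simp; ring
  refine ⟨fun p => solE ω φ p - 1, fun p => solE ω φ p * (1 + Qf φ (p.1, p.2 * solE ω φ p)) *
    (1 + deriv φ (p.1 + ω + p.2 * solE ω φ p)) - 1, ?_, ?_, ?_, ?_, ?_, ?_, ?_, ?_⟩
  · intro z w
    simp only [solE_per ω hper z w]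
  · intro z w
    simp only [solE_per ω hper z w, Qf_per hper]
    have : z + 1 + (ω : ℂ) + w * solE ω φ (z, w) = z + ω + w * solE ω φ (z, w) + 1 := by ring
    rw [this, hper.deriv]
  · intro p hp
    exact (hea p hp).sub analyticAt_const
  · intro p hp
    have ha := hea p hp
    have hs := hsol p hp
    have hm : AnalyticAt ℂ (fun p : ℂ × ℂ => p.2 * solE ω φ p) p := analyticAt_snd.mul ha
    refine ((ha.mul (analyticAt_const.add ?_)).mul (analyticAt_const.add ?_)).sub analyticAt_const
    · exact Qf_comp_analytic hana analyticAt_fst hm hs.1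
    · refine deriv_comp_analytic hana ((analyticAt_fst.add analyticAt_const).add hm) ?_
      exact mem_strip_add (by rw [im_shift]; exact hs.1)
  · intro p hp
    have hs := hsol p hp
    beta_reduce
    generalize solE ω φ p = e at hs ⊢
    have k1 : p.1 + (ω : ℂ) + p.2 + p.2 * (e - 1) = p.1 + ω + p.2 * e := by ring
    have k2 : p.1 + p.2 + p.2 * (e - 1) = p.1 + p.2 * e := by ring
    rw [k1, k2]
    constructor
    · have := Bf_mul (φ := φ) (p.1 + ω) p.2 e
      rw [div_eq_mul_one_div]
      linear_combination p.2 * hs.2 - this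
    · have := Qf_mul φ p.1 (p.2 * e)
      linear_combination (1 + deriv φ (p.1 + ω + p.2 * e)) * this
  · exact triSup_le hfb
  · refine triSup_le fun p hp => ?_
    rw [add_sub_cancel]
    exact Sol_bound hana hM hM1 (hsol p hp)
  · refine triSup_le fun p hp => ?_
    have hs := hsol p hp
    have hf := hfb p hp
    have hb := Bf_bound hana hM hs.1
    have he := Sol_bound hana hM hM1 hs
    have hd := hM _ (mem_strip_add (a := p.1 + ω) (by rw [im_shift]; exact hs.1))
    set e := solE ω φ p
    set d := deriv φ (p.1 + ω + p.2 * e)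
    have heq : e * (1 + Qf φ (p.1, p.2 * e)) * (1 + d) - 1 =
        (e - 1) + e * d + Bf φ p.1 p.2 e * (1 + d) := by rw [Bf]; ring
    rw [heq]
    have hd1 : ‖1 + d‖ ≤ 1 + M := (norm_add_le _ _).trans (by rw [norm_one]; linarith)
    have hb' : ‖Bf φ p.1 p.2 e‖ ≤ M * (1 / (1 - M) ^ 2) :=
      hb.trans (mul_le_mul_of_nonneg_left he hM0)
    calc _ ≤ ‖e - 1‖ + ‖e‖ * ‖d‖ + ‖Bf φ p.1 p.2 e‖ * ‖1 + d‖ := by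
          refine (norm_add_le _ _).trans ?_
          rw [norm_mul]
          refine add_le_add_left ((norm_add_le _ _).trans ?_) _
          rw [norm_mul]
      _ ≤ M * (2 - M) / (1 - M) ^ 2 + 1 / (1 - M) ^ 2 * M +
            M * (1 / (1 - M) ^ 2) * (1 + M) := by
          gcongr
      _ = 4 * M / (1 - M) ^ 2 := by field_simp; ring
      _ ≤ _ := by
          have h4 : 4 * M ≤ 2 * M * (2 + M) := by nlinarith
          gcongr

lemma phiDerSup_facts (hper : Per1 φ) (hana : AnalyticOnNhd ℂ φ (strip 1))
    (hnorm : fwNormLE (deriv^[3] φ) 1) :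
    (∀ z ∈ strip 1, ‖deriv φ z‖ ≤ phiDerSup φ) ∧ 0 ≤ phiDerSup φ ∧ phiDerSup φ < 1 := by
  have hb := phi_deriv_bound φ hper hana hnorm
  have hle : ∀ z ∈ strip 1, ‖deriv φ z‖ ≤ phiDerSup φ := by
    intro z hz
    refine le_csSup ⟨1 / 4, ?_⟩ ⟨z, hz, rfl⟩
    rintro _ ⟨w, hw, rfl⟩
    exact hb w hw
  have h0 : (0:ℂ) ∈ strip 1 := by simp [strip]
  refine ⟨hle, (norm_nonneg _).trans (hle 0 h0), ?_⟩
  have : phiDerSup φ ≤ 1 / 4 := by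
    refine csSup_le ⟨_, 0, h0, rfl⟩ ?_
    rintro _ ⟨w, hw, rfl⟩
    exact hb w hw
  linarith

end Main

end Helpers

/-- **Lemma (the reduced adapted-coordinates data `f̄`, `ḡ` on `D_λ`).** -/
theorem reduced_adapted_data_on_triangular_domain
    (ω : ℝ) (φ : ℂ → ℂ)
    (hper : Per1 φ) (hana : AnalyticOnNhd ℂ φ (strip 1))
    (hnorm : fwNormLE (deriv^[3] φ) 1) :
    ∃ fb gb : ℂ × ℂ → ℂ,
      Per1' fb ∧ Per1' gb ∧
      AnalyticOnNhd ℂ fb (Dtri ((1 - phiDerSup φ) ^ 2)) ∧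
      AnalyticOnNhd ℂ gb (Dtri ((1 - phiDerSup φ) ^ 2)) ∧
      -- `f = y f̄` and `g = y ḡ` solve the adapted-coordinates system on `D_λ`
      (∀ p ∈ Dtri ((1 - phiDerSup φ) ^ 2),
        p.2 + p.2 * fb p =
          p.2 / (1 + deriv φ p.1) + φ (p.1 + (ω : ℂ)) -
            φ (p.1 + (ω : ℂ) + p.2 + p.2 * fb p) ∧
        p.2 + p.2 * gb p =
          (p.2 + p.2 * fb p + φ (p.1 + p.2 + p.2 * fb p) - φ p.1) *
            (1 + deriv φ (p.1 + (ω : ℂ) + p.2 + p.2 * fb p))) ∧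
      -- the sup-norm bounds
      triSup ((1 - phiDerSup φ) ^ 2) fb ≤
        ENNReal.ofReal (phiDerSup φ * (2 - phiDerSup φ) / (1 - phiDerSup φ) ^ 2) ∧
      triSup ((1 - phiDerSup φ) ^ 2) (fun p => 1 + fb p) ≤
        ENNReal.ofReal (1 / (1 - phiDerSup φ) ^ 2) ∧
      triSup ((1 - phiDerSup φ) ^ 2) gb ≤
        ENNReal.ofReal (2 * phiDerSup φ * (2 + phiDerSup φ) / (1 - phiDerSup φ) ^ 2) := by
  obtain ⟨hM, hM0, hM1⟩ := phiDerSup_facts hper hana hnorm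
  exact main_aux ω hper hana hM hM0 hM1

end
end

section
/- Let p, q be coprime integers with q > 0 and let F(x,y) = (x + p/q + y + f(x,y), y + g(x,y)) with f, g analytic on 𝕋_a × D_b. Suppose a' < a satisfies b + |f|_{a,b} ≤ (a−a')/q and |f|_{a,b} + ((3q−1)/2)|g|_{a,b} < b. Set b' = b − q|g|_{a,b} and b'' = |f|_{a,b} + ((q−1)/2)|g|_{a,b}. Then all (p,q)-periodic orbits of F restricted to 𝕋_{a'} × D_{b'} lie in 𝕋_{a'} × D_{b''}. More precisely, there exist analytic γ, Γ : 𝕋_{a'} → ℂ, depending analytically on f and g, with |γ|_{a'} ≤ b'' and |Γ|_{a'} ≤ q|g|_{a,b}, such that (x,y) ∈ 𝕋_{a'} × D_{b'} is a (p,q)-periodic point of F iff y = γ(x) and Γ(x) = 0. Moreover, with ā = 2q|f|_{a,b} + q(q−1)|g|_{a,b} and b̄ = |f|_{a,b} + ((3q−1)/2)|g|_{a,b}: |Γ(x) − Σ_{k=0}^{q−1} g(x + k/q, 0)| ≤ q(ā/(a−a'−ā) + b̄/(b−b̄))·|g|_{a,b} for all x ∈ 𝕋_{a'}, and |det(d_{(x,γ(x))}F^q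 − id) + q·Γ'(x)| ≤ (ā/2)·|Γ'(x)|/(b' − |γ(x)|). -/
/-!
Statement 19 (Lemma gam): characterization of the `(p,q)`-periodic orbits of a
near-integrable map `F(x,y) = (x + p/q + y + f(x,y), y + g(x,y))` through a pair of
analytic functions `γ, Γ` on `𝕋_{a'}`, with quantitative estimates.  Stated in
parametrized form over analytic families `(f^τ, g^τ)`, expressing that `γ` and `Γ`
depend analytically on `f` and `g`.
-/

open Real Set

noncomputable section

def domAB (a b : ℝ) : Set (ℂ × ℂ) := {p : ℂ × ℂ | |p.1.im| < a ∧ ‖p.2‖ < b}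

/-- The near-integrable map `F(x,y) = (x + p/q + y + f(x,y), y + g(x,y))`. -/
def nearIntMap (pp : ℤ) (q : ℕ) (f g : ℂ × ℂ → ℂ) : ℂ × ℂ → ℂ × ℂ :=
  fun z => (z.1 + (pp : ℂ) / (q : ℂ) + z.2 + f z, z.2 + g z)


lemma aux_re_nonpos (ρ : ℝ) (hρ : 0 < ρ) (H : ℂ → ℂ)
    (hd : DiffContOnCl ℂ H (Metric.ball 0 ρ)) (h0 : H 0 = 0) :
    ∃ y : ℂ, ‖y‖ = ρ ∧ (H y).re ≤ 0 := by
  have hd' : DiffContOnCl ℂ (fun y => Complex.exp (-(H y))) (Metric.ball 0 ρ) :=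
    Complex.differentiable_exp.comp_diffContOnCl hd.neg
  obtain ⟨z, hz, hmax⟩ := Complex.exists_mem_frontier_isMaxOn_norm
    Metric.isBounded_ball ⟨0, Metric.mem_ball_self hρ⟩ hd'
  rw [frontier_ball _ hρ.ne'] at hz
  refine ⟨z, by simpa using hz, ?_⟩
  have h1 := hmax (subset_closure (Metric.mem_ball_self hρ))
  simp only [mem_ofPred_eq, Function.comp, Complex.norm_exp, h0, Complex.neg_re, Complex.zero_re,
    Real.exp_le_exp] at h1
  linarith

lemma aux_re_pos (T y : ℂ) (h : ‖T‖ < ‖y‖) : 0 < ((y - T) * (starRingEnd ℂ) y).re := by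
  have h1 : ‖T * (starRingEnd ℂ) y‖ < ‖y‖ ^ 2 := by
    rw [norm_mul, RCLike.norm_conj, sq]
    exact mul_lt_mul_of_pos_right h ((norm_nonneg _).trans_lt h)
  have h2 := (Complex.re_le_norm (T * (starRingEnd ℂ) y))
  rw [sub_mul, Complex.mul_conj, Complex.sub_re, Complex.ofReal_re, Complex.normSq_eq_norm_sq]
  linarith

lemma aux_exists_fixed (R r : ℝ) (hr0 : 0 ≤ r) (hr : r < R) (T : ℂ → ℂ)
    (hT : DifferentiableOn ℂ T (Metric.ball 0 R)) (hb : ∀ y, ‖y‖ < R → ‖T y‖ ≤ r) :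
    ∃ y, ‖y‖ < R ∧ T y = y := by
  by_contra! hne
  obtain ⟨ρ, h1, h2⟩ := exists_between hr
  have hρ : 0 < ρ := by linarith
  have hsub : Metric.closedBall (0 : ℂ) ρ ⊆ Metric.ball 0 R :=
    Metric.closedBall_subset_ball h2
  have hd : DiffContOnCl ℂ (fun y => y / (y - T y)) (Metric.ball 0 ρ) := by
    apply DifferentiableOn.diffContOnCl
    rw [closure_ball _ hρ.ne']
    refine DifferentiableOn.div differentiableOn_id (differentiableOn_id.sub (hT.mono hsub)) ?_
    intro y hy
    have := hne y (by simpa using hsub hy)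
    exact sub_ne_zero.2 (Ne.symm this)
  obtain ⟨y, hy, hre⟩ := aux_re_nonpos ρ hρ _ hd (by simp)
  have hTy := hb y (by linarith)
  have hpos := aux_re_pos (T y) y (by linarith)
  have hu : y - T y ≠ 0 := sub_ne_zero.2 (Ne.symm (hne y (by linarith)))
  rw [div_eq_mul_inv, Complex.inv_def, ← mul_assoc, Complex.re_mul_ofReal] at hre
  have h3 : (y * (starRingEnd ℂ) (y - T y)).re = ((y - T y) * (starRingEnd ℂ) y).re := by
    simp [Complex.mul_re]; ring
  rw [h3] at hre
  have : 0 < (Complex.normSq (y - T y))⁻¹ := inv_pos.2 (Complex.normSq_pos.2 hu)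
  nlinarith [mul_pos hpos this]

lemma aux_mul_eq (ρ : ℝ) (y p : ℂ) (hy : ‖y‖ = ρ) :
    (y - p) * ((ρ : ℂ) ^ 2 - (starRingEnd ℂ) p * y) = y * (Complex.normSq (y - p) : ℂ) := by
  have : (ρ : ℂ) ^ 2 = y * (starRingEnd ℂ) y := by
    rw [Complex.mul_conj, Complex.normSq_eq_norm_sq, hy]; push_cast; rfl
  rw [this, ← Complex.mul_conj, map_sub]; ring

lemma aux_ne (ρ : ℝ) (y p : ℂ) (hy : ‖y‖ ≤ ρ) (hp : ‖p‖ < ρ) :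
    ((ρ : ℂ) ^ 2 - (starRingEnd ℂ) p * y) ≠ 0 := by
  intro h
  have h1 : (ρ : ℂ) ^ 2 = (starRingEnd ℂ) p * y := sub_eq_zero.1 h
  have h2 := congrArg norm h1
  rw [norm_pow, norm_mul, RCLike.norm_conj, Complex.norm_real, Real.norm_eq_abs, sq_abs] at h2
  nlinarith [norm_nonneg y, norm_nonneg p]

lemma aux_dslope_ne (R r : ℝ) (hr : r < R) (T : ℂ → ℂ)
    (hT : DifferentiableOn ℂ T (Metric.ball 0 R)) (hb : ∀ y, ‖y‖ < R → ‖T y‖ ≤ r)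
    (p p2 : ℂ) (hp : ‖p‖ < R) (hp2 : ‖p2‖ < R) (hpT : T p = p) 
    (h : dslope (fun y => y - T y) p p2 = 0) : False := by
  obtain ⟨ρ, h1, h2⟩ := exists_between (max_lt hr (max_lt hp hp2))
  simp only [max_lt_iff] at h1
  obtain ⟨h1, h1p, h1p2⟩ := h1
  have hρ : 0 < ρ := (norm_nonneg _).trans_lt h1p
  have hsub : Metric.closedBall (0 : ℂ) ρ ⊆ Metric.ball 0 R :=
    Metric.closedBall_subset_ball h2
  set u : ℂ → ℂ := fun y => y - T y with hu
  have hud : DifferentiableOn ℂ u (Metric.ball 0 R) := differentiableOn_id.sub hT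
  have hu1 : DifferentiableOn ℂ (dslope u p) (Metric.ball 0 R) :=
    (Complex.differentiableOn_dslope (Metric.isOpen_ball.mem_nhds (by simpa using hp))).2 hud
  have hu2 : DifferentiableOn ℂ (dslope (dslope u p) p2) (Metric.ball 0 R) :=
    (Complex.differentiableOn_dslope (Metric.isOpen_ball.mem_nhds (by simpa using hp2))).2 hu1
  have e1 : ∀ y, (y - p) * dslope u p y = u y := by
    intro y
    have := sub_smul_dslope u p y
    simpa [hu, hpT] using this
  have e2 : ∀ y, (y - p2) * dslope (dslope u p) p2 y = dslope u p y := by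
    intro y
    have := sub_smul_dslope (dslope u p) p2 y
    simpa [h] using this
  set H : ℂ → ℂ := fun y => dslope (dslope u p) p2 y * y /
    (((ρ : ℂ) ^ 2 - (starRingEnd ℂ) p * y) * ((ρ : ℂ) ^ 2 - (starRingEnd ℂ) p2 * y)) with hH
  have hd : DiffContOnCl ℂ H (Metric.ball 0 ρ) := by
    apply DifferentiableOn.diffContOnCl
    rw [closure_ball _ hρ.ne']
    refine DifferentiableOn.div ((hu2.mono hsub).mul differentiableOn_id) (by fun_prop) ?_
    intro y hy
    have hy' : ‖y‖ ≤ ρ := by simpa using hy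
    exact mul_ne_zero (aux_ne ρ y p hy' h1p) (aux_ne ρ y p2 hy' h1p2)
  obtain ⟨y, hy, hre⟩ := aux_re_nonpos ρ hρ H hd (by simp [hH])
  have hpos := aux_re_pos (T y) y (by linarith [hb y (by linarith)])
  have hy0 : y ≠ 0 := by rintro rfl; simp at hy; linarith
  have hyp : y - p ≠ 0 := by
    intro h; rw [sub_eq_zero.1 h] at hy; linarith
  have hyp2 : y - p2 ≠ 0 := by
    intro h; rw [sub_eq_zero.1 h] at hy; linarith
  have m1 := aux_mul_eq ρ y p hy
  have m2 := aux_mul_eq ρ y p2 hy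
  have n1 : 0 < Complex.normSq (y - p) := Complex.normSq_pos.2 hyp
  have n2 : 0 < Complex.normSq (y - p2) := Complex.normSq_pos.2 hyp2
  have key : H y = ((Complex.normSq (y - p) * Complex.normSq (y - p2) * ρ ^ 2)⁻¹ : ℝ) *
      ((y - T y) * (starRingEnd ℂ) y) := by
    have k0 : (ρ : ℂ) ^ 2 = y * (starRingEnd ℂ) y := by
      rw [Complex.mul_conj, Complex.normSq_eq_norm_sq, hy]; push_cast; rfl
    have c1 : (Complex.normSq (y - p) : ℂ) ≠ 0 := by exact_mod_cast n1.ne'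
    have c2 : (Complex.normSq (y - p2) : ℂ) ≠ 0 := by exact_mod_cast n2.ne'
    have c3 : (ρ : ℂ) ≠ 0 := by exact_mod_cast hρ.ne'
    have d1 := aux_ne ρ y p hy.le h1p
    have d2 := aux_ne ρ y p2 hy.le h1p2
    have hTe : y - T y = (y - p) * ((y - p2) * dslope (dslope u p) p2 y) := by rw [e2, e1]
    rw [hTe, hH]
    push_cast
    rw [div_eq_iff (mul_ne_zero d1 d2)]
    generalize (dslope (dslope u p) p2 y) = v
    field_simp
    calc _ = v * y * (Complex.normSq (y - p) : ℂ) * (Complex.normSq (y - p2) : ℂ) * (ρ : ℂ)^2 := by ring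
      _ = v * (y * (Complex.normSq (y - p) : ℂ)) * (y * (Complex.normSq (y - p2) : ℂ)) *
            (starRingEnd ℂ) y := by rw [k0]; ring
      _ = _ := by rw [← m1, ← m2]; ring
  rw [key, Complex.re_ofReal_mul] at hre
  have : 0 < (Complex.normSq (y - p) * Complex.normSq (y - p2) * ρ ^ 2)⁻¹ := by positivity
  nlinarith [mul_pos this hpos]

lemma aux_unique_fixed (R r : ℝ) (hr : r < R) (T : ℂ → ℂ)
    (hT : DifferentiableOn ℂ T (Metric.ball 0 R)) (hb : ∀ y, ‖y‖ < R → ‖T y‖ ≤ r)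
    (p p2 : ℂ) (hp : ‖p‖ < R) (hp2 : ‖p2‖ < R) (hpT : T p = p) (hpT2 : T p2 = p2) : p2 = p := by
  by_contra hne
  refine aux_dslope_ne R r hr T hT hb p p2 hp hp2 hpT ?_
  rw [dslope_of_ne _ hne, slope_def_field]
  simp [hpT, hpT2]

lemma aux_deriv_ne (R r : ℝ) (hr : r < R) (T : ℂ → ℂ)
    (hT : DifferentiableOn ℂ T (Metric.ball 0 R)) (hb : ∀ y, ‖y‖ < R → ‖T y‖ ≤ r)
    (p : ℂ) (hp : ‖p‖ < R) (hpT : T p = p) : deriv (fun y => y - T y) p ≠ 0 := by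
  intro h
  refine aux_dslope_ne R r hr T hT hb p p hp hp hpT ?_
  rw [dslope_same, h]

/-- Cauchy estimate on an open disc. -/
lemma aux_cauchy (c : ℂ) (R C : ℝ) (hR : 0 < R) (h : ℂ → ℂ)
    (hd : DifferentiableOn ℂ h (Metric.ball c R)) (hC : ∀ z ∈ Metric.ball c R, ‖h z‖ ≤ C) :
    ‖deriv h c‖ ≤ C / R := by
  have hev : ∀ᶠ ρ in nhdsWithin R (Iio R), ‖deriv h c‖ ≤ C / ρ := by
    filter_upwards [Ioo_mem_nhdsLT hR] with ρ hρ
    have hs := Metric.closedBall_subset_ball (x := c) hρ.2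
    refine Complex.norm_deriv_le_of_forall_mem_sphere_norm_le hρ.1 ?_
      (fun z hz => hC z (hs (Metric.sphere_subset_closedBall hz)))
    apply DifferentiableOn.diffContOnCl
    rw [closure_ball _ hρ.1.ne']
    exact hd.mono hs
  refine ge_of_tendsto ?_ hev
  exact (tendsto_const_nhds.div Filter.tendsto_id hR.ne').mono_left nhdsWithin_le_nhds

lemma aux_det (L : (ℂ × ℂ) →L[ℂ] (ℂ × ℂ)) :
    L.det = (L (1, 0)).1 * (L (0, 1)).2 - (L (0, 1)).1 * (L (1, 0)).2 := by
  rw [ContinuousLinearMap.det, ← LinearMap.det_toMatrix (Module.Basis.finTwoProd ℂ),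
    Matrix.det_fin_two]
  simp [LinearMap.toMatrix_apply]

lemma aux_det_formula (P : ℂ × ℂ → ℂ × ℂ) (γ Γ : ℂ → ℂ) (x c k : ℂ)
    (hP : DifferentiableAt ℂ P (x, γ x)) (hγ : DifferentiableAt ℂ γ x)
    (h1 : ∀ᶠ s in nhds x, (P (s, γ s)).1 = s + c)
    (h2 : ∀ᶠ s in nhds x, Γ s = (P (s, γ s)).2 - γ s) :
    (fderiv ℂ P (x, γ x) - ContinuousLinearMap.id ℂ (ℂ × ℂ)).det + k * deriv Γ x =
      - deriv (fun y => (P (x, y)).1 - x - c - k * y) (γ x) * deriv Γ x := by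
  have hL := hP.hasFDerivAt
  set L := fderiv ℂ P (x, γ x)
  have hc : HasDerivAt (fun s => (s, γ s)) ((1 : ℂ), deriv γ x) x :=
    (hasDerivAt_id x).prodMk hγ.hasDerivAt
  have hPc : HasDerivAt (fun s => P (s, γ s)) (L (1, deriv γ x)) x :=
    HasFDerivAt.comp_hasDerivAt (f := fun s => (s, γ s)) x hL hc
  have hy : HasDerivAt (fun y => P (x, y)) (L (0, 1)) (γ x) :=
    HasFDerivAt.comp_hasDerivAt (f := fun y => (x, y)) (γ x) hL
      ((hasDerivAt_const _ x).prodMk (hasDerivAt_id _))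
  have hsplit : L (1, deriv γ x) = L (1, 0) + deriv γ x • L (0, 1) := by
    rw [← map_smul, ← map_add]; simp
  have a1 : (L (1, deriv γ x)).1 = 1 := by
    have q1 : HasDerivAt (fun s => (P (s, γ s)).1) (L (1, deriv γ x)).1 x := hPc.fst
    have q2 : HasDerivAt (fun s => s + c) 1 x := (hasDerivAt_id x).add_const c
    exact (q1.congr_of_eventuallyEq (Filter.EventuallyEq.symm h1)).unique q2
  have a2 : deriv Γ x = (L (1, deriv γ x)).2 - deriv γ x := by
    have q1 : HasDerivAt (fun s => (P (s, γ s)).2) (L (1, deriv γ x)).2 x := hPc.snd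
    exact ((q1.sub hγ.hasDerivAt).congr_of_eventuallyEq h2).deriv
  have a3 : deriv (fun y => (P (x, y)).1 - x - c - k * y) (γ x) = (L (0, 1)).1 - k := by
    have q1 : HasDerivAt (fun s => (P (x, s)).1) (L (0, 1)).1 (γ x) := hy.fst
    have q2 := (((q1.sub_const x).sub_const c).sub ((hasDerivAt_id (γ x)).const_mul k)).deriv
    rw [mul_one] at q2
    exact q2
  rw [aux_det, a3, a2]
  rw [hsplit] at a1 ⊢
  simp at a1 ⊢
  linear_combination ((L (0, 1)).2 - 1) * a1

lemma aux_orbit (pp : ℤ) (q : ℕ) (hq : 0 < q) (a a' b Mf Mg : ℝ)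
    (hMf : 0 ≤ Mf) (hMg : 0 ≤ Mg) (hb : 0 < b)
    (hcond1 : b + Mf ≤ (a - a') / (q : ℝ)) (f g : ℂ × ℂ → ℂ)
    (hbound : ∀ z ∈ domAB a b, ‖f z‖ ≤ Mf ∧ ‖g z‖ ≤ Mg)
    (z : ℂ × ℂ) (hz : z ∈ domAB a' (b - (q : ℝ) * Mg)) (j : ℕ) (hj : j ≤ q) :
    (nearIntMap pp q f g)^[j] z ∈ domAB a b ∧
    ‖((nearIntMap pp q f g)^[j] z).2 - z.2‖ ≤ j * Mg ∧
    |((nearIntMap pp q f g)^[j] z).1.im| ≤ |z.1.im| + j * (b + Mf) ∧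
    ‖((nearIntMap pp q f g)^[j] z).1 - z.1 - j * ((pp : ℂ) / q) - j * z.2‖ ≤
      j * Mf + (j : ℝ) * ((j : ℝ) - 1) / 2 * Mg := by
  have hq' : (0 : ℝ) < q := by exact_mod_cast hq
  have hc : (b + Mf) * q ≤ a - a' := (le_div_iff₀ hq').1 hcond1
  have hmem : ∀ (w : ℂ × ℂ) (j : ℕ), j ≤ q → ‖w.2 - z.2‖ ≤ j * Mg →
      |w.1.im| ≤ |z.1.im| + j * (b + Mf) → w ∈ domAB a b := by
    intro w j hj h1 h2
    have hj' : (j : ℝ) ≤ q := by exact_mod_cast hj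
    have hz1 : |z.1.im| < a' := hz.1
    have hz2 : ‖z.2‖ < b - q * Mg := hz.2
    refine ⟨?_, ?_⟩
    · have : (j : ℝ) * (b + Mf) ≤ q * (b + Mf) := by gcongr
      linarith
    · have h3 : ‖w.2‖ ≤ ‖w.2 - z.2‖ + ‖z.2‖ := by
        simpa using norm_add_le (w.2 - z.2) z.2
      have : (j : ℝ) * Mg ≤ q * Mg := by gcongr
      linarith
  suffices H : ‖((nearIntMap pp q f g)^[j] z).2 - z.2‖ ≤ j * Mg ∧
    |((nearIntMap pp q f g)^[j] z).1.im| ≤ |z.1.im| + j * (b + Mf) ∧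
    ‖((nearIntMap pp q f g)^[j] z).1 - z.1 - j * ((pp : ℂ) / q) - j * z.2‖ ≤
      j * Mf + (j : ℝ) * ((j : ℝ) - 1) / 2 * Mg from
    ⟨hmem _ j hj H.1 H.2.1, H⟩
  induction j with
  | zero => simp
  | succ j ih =>
    obtain ⟨i1, i2, i3⟩ := ih (by omega)
    have hm := hmem _ j (by omega) i1 i2
    rw [Function.iterate_succ_apply']
    set w := (nearIntMap pp q f g)^[j] z
    obtain ⟨bf, bg⟩ := hbound w hm
    have hw2 : ‖w.2‖ < b := hm.2
    refine ⟨?_, ?_, ?_⟩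
    · have : (nearIntMap pp q f g w).2 - z.2 = (w.2 - z.2) + g w := by
        simp only [nearIntMap]; ring
      rw [this]; push_cast
      linarith [norm_add_le (w.2 - z.2) (g w)]
    · have e : (nearIntMap pp q f g w).1.im = w.1.im + (w.2.im + (f w).im) := by
        have : ((pp : ℂ) / (q : ℂ)).im = 0 := by
          rw [show ((pp : ℂ) / (q : ℂ)) = (((pp : ℝ) / (q : ℝ) : ℝ) : ℂ) by push_cast; rfl]
          exact Complex.ofReal_im _
        simp only [nearIntMap, Complex.add_im, this]; ring
      rw [e]; push_cast
      have := abs_add_le w.1.im (w.2.im + (f w).im)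
      have := abs_add_le w.2.im (f w).im
      have := Complex.abs_im_le_norm w.2
      have := Complex.abs_im_le_norm (f w)
      linarith
    · have : (nearIntMap pp q f g w).1 - z.1 - ((j + 1 : ℕ) : ℂ) * ((pp : ℂ) / q)
          - ((j + 1 : ℕ) : ℂ) * z.2 =
          (w.1 - z.1 - j * ((pp : ℂ) / q) - j * z.2) + (w.2 - z.2) + f w := by
        simp only [nearIntMap]; push_cast; ring
      rw [this]; push_cast
      have := norm_add₃_le (a := w.1 - z.1 - j * ((pp : ℂ) / q) - j * z.2) (b := w.2 - z.2)
        (c := f w)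
      linarith

lemma aux_sum (pp : ℤ) (q : ℕ) (f g : ℂ × ℂ → ℂ) (z : ℂ × ℂ) (j : ℕ) :
    ((nearIntMap pp q f g)^[j] z).2 - z.2 =
      ∑ k ∈ Finset.range j, g ((nearIntMap pp q f g)^[k] z) := by
  induction j with
  | zero => simp
  | succ j ih =>
    rw [Finset.sum_range_succ, ← ih, Function.iterate_succ_apply']
    simp only [nearIntMap]; ring

lemma aux_per (pp : ℤ) (q : ℕ) (f g : ℂ × ℂ → ℂ) (hf : Per1' f) (hg : Per1' g)
    (x y : ℂ) (j : ℕ) :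
    (nearIntMap pp q f g)^[j] (x + 1, y) =
      (((nearIntMap pp q f g)^[j] (x, y)).1 + 1, ((nearIntMap pp q f g)^[j] (x, y)).2) := by
  induction j with
  | zero => simp
  | succ j ih =>
    rw [Function.iterate_succ_apply', Function.iterate_succ_apply', ih]
    set w := (nearIntMap pp q f g)^[j] (x, y)
    simp only [nearIntMap, hf w.1 w.2, hg w.1 w.2]
    ext <;> simp; ring

lemma aux_reindex (pp : ℤ) (q : ℕ) (hq : 0 < q) (hcop : Int.gcd pp q = 1)
    (g : ℂ × ℂ → ℂ) (hg : Per1' g) (x : ℂ) :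
    ∑ k ∈ Finset.range q, g (x + (k : ℂ) * ((pp : ℂ) / q), 0) =
      ∑ k ∈ Finset.range q, g (x + (k : ℂ) / (q : ℂ), 0) := by
  have hq' : (q : ℂ) ≠ 0 := by exact_mod_cast hq.ne'
  have hqz : (0 : ℤ) < q := by exact_mod_cast hq
  have hperN : ∀ (n : ℕ) (s : ℂ), g (s + n, 0) = g (s, 0) := by
    intro n
    induction n with
    | zero => simp
    | succ n ih => intro s; rw [← ih s, ← hg (s + n)]; push_cast; ring_nf
  have hperZ : ∀ (n : ℤ) (s : ℂ), g (s + n, 0) = g (s, 0) := by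
    intro n s
    obtain ⟨m, rfl | rfl⟩ := n.eq_nat_or_neg
    · exact_mod_cast hperN m s
    · rw [← hperN m (s + _)]; push_cast; ring_nf
  have hnn : ∀ k : ℕ, 0 ≤ ((k : ℤ) * pp) % q := fun k => Int.emod_nonneg _ hqz.ne'
  set i : ℕ → ℕ := fun k => (((k : ℤ) * pp) % q).toNat with hi
  have hiz : ∀ k, ((i k : ℕ) : ℤ) = ((k : ℤ) * pp) % q := fun k => Int.toNat_of_nonneg (hnn k)
  have hmaps : ∀ k ∈ Finset.range q, i k ∈ Finset.range q := by
    intro k _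
    rw [Finset.mem_range]
    have := Int.emod_lt_of_pos ((k : ℤ) * pp) hqz
    have := hiz k
    omega
  have hinj : Set.InjOn i (Finset.range q : Set ℕ) := by
    intro k hk l hl hkl
    simp only [Finset.coe_range, Set.mem_Iio] at hk hl
    have h1 : ((k : ℤ) * pp) % q = ((l : ℤ) * pp) % q := by rw [← hiz, ← hiz, hkl]
    have h2 : (q : ℤ) ∣ ((l : ℤ) - k) * pp := by
      have := Int.ModEq.dvd (show (k : ℤ) * pp ≡ (l : ℤ) * pp [ZMOD q] from h1)
      rwa [← sub_mul] at this
    have h3 : (q : ℤ) ∣ (l : ℤ) - k := by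
      refine Int.dvd_of_dvd_mul_left_of_gcd_one h2 ?_
      rw [Int.gcd_comm]; exact hcop
    have := Int.eq_zero_of_abs_lt_dvd h3 (by rw [abs_lt]; omega)
    omega
  refine Finset.sum_nbij i hmaps hinj ?_ ?_
  · exact Finset.surjOn_of_injOn_of_card_le i hmaps hinj le_rfl
  · intro k _
    have h1 : (k : ℤ) * pp = (i k : ℤ) + q * (((k : ℤ) * pp) / q) := by
      rw [hiz]; exact (Int.emod_add_mul_ediv _ _).symm
    have h2 : (k : ℂ) * pp = (i k : ℂ) + q * (((((k : ℤ) * pp) / q : ℤ)) : ℂ) := by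
      exact_mod_cast h1
    rw [← hperZ (((k : ℤ) * pp) / q) (x + (i k : ℂ) / q)]
    congr 2
    rw [← mul_div_assoc, h2]
    field_simp
    ring

lemma aux_gdiff (a a' b A B Mg : ℝ) (g : ℂ × ℂ → ℂ)
    (hg : DifferentiableOn ℂ g (domAB a b)) (hbd : ∀ z ∈ domAB a b, ‖g z‖ ≤ Mg)
    (hMg : 0 ≤ Mg) 
    (hA : A < a - a') (hB : B < b) (x0 ξ η : ℂ) (hx : |x0.im| < a') (hξ : ‖ξ‖ ≤ A)
    (hη : ‖η‖ ≤ B) :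
    ‖g (x0 + ξ, η) - g (x0, 0)‖ ≤ (A / (a - a' - A) + B / (b - B)) * Mg := by
  have hA0 : 0 ≤ A := (norm_nonneg _).trans hξ
  have hB0 : 0 ≤ B := (norm_nonneg _).trans hη
  have hopen : IsOpen (domAB a b) := by
    have h1 : IsOpen {p : ℂ × ℂ | |p.1.im| < a} := isOpen_lt (by fun_prop) continuous_const
    have h2 : IsOpen {p : ℂ × ℂ | ‖p.2‖ < b} := isOpen_lt (by fun_prop) continuous_const
    exact h1.inter h2
  have hgA : ∀ z ∈ domAB a b, DifferentiableAt ℂ g z :=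
    fun z hz => hg.differentiableAt (hopen.mem_nhds hz)
  have hx1 : ∀ s : ℂ, ‖s - x0‖ < a - a' → (s, η) ∈ domAB a b := by
    intro s hs
    refine ⟨?_, by simp only; linarith⟩
    have h1 := Complex.abs_im_le_norm (s - x0)
    have h2 := abs_add_le (s - x0).im x0.im
    rw [Complex.sub_im] at h1 h2
    simp only [sub_add_cancel] at h2
    simp only; linarith
  have hy1 : ∀ t : ℂ, ‖t‖ < b → (x0, t) ∈ domAB a b := by
    intro t ht
    refine ⟨?_, ht⟩
    simp only; linarith
  have P1 : ‖g (x0 + ξ, η) - g (x0, η)‖ ≤ Mg / (a - a' - A) * ‖x0 + ξ - x0‖ := by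
    refine Convex.norm_image_sub_le_of_norm_deriv_le (f := fun s => g (s, η)) (𝕜 := ℂ)
      (s := Metric.closedBall x0 A) ?_ ?_ (convex_closedBall _ _) (by simpa using hA0)
      (by simpa using hξ)
    · intro s hs
      rw [mem_closedBall_iff_norm] at hs
      have := hgA _ (hx1 s (by linarith))
      exact DifferentiableAt.comp (f := fun s : ℂ => (s, η)) s this (by fun_prop)
    · intro s hs
      rw [mem_closedBall_iff_norm] at hs
      have hin : ∀ r ∈ Metric.ball s (a - a' - A), (r, η) ∈ domAB a b := by
        intro r hr
        rw [mem_ball_iff_norm] at hr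
        refine hx1 r ?_
        have := norm_add_le (r - s) (s - x0)
        rw [sub_add_sub_cancel] at this
        linarith
      refine aux_cauchy s _ Mg (by linarith) _ ?_ (fun r hr => hbd _ (hin r hr))
      intro r hr
      have := hgA _ (hin r hr)
      exact (DifferentiableAt.comp (f := fun s : ℂ => (s, η)) r this
        (by fun_prop)).differentiableWithinAt
  have P2 : ‖g (x0, η) - g (x0, 0)‖ ≤ Mg / (b - B) * ‖η - 0‖ := by
    refine Convex.norm_image_sub_le_of_norm_deriv_le (f := fun t => g (x0, t)) (𝕜 := ℂ)
      (s := Metric.closedBall 0 B) ?_ ?_ (convex_closedBall _ _) (by simpa using hB0)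
      (by simpa using hη)
    · intro s hs
      rw [mem_closedBall_zero_iff] at hs
      have := hgA _ (hy1 s (by linarith))
      exact DifferentiableAt.comp (f := fun t : ℂ => (x0, t)) s this (by fun_prop)
    · intro s hs
      rw [mem_closedBall_zero_iff] at hs
      have hin : ∀ r ∈ Metric.ball s (b - B), (x0, r) ∈ domAB a b := by
        intro r hr
        rw [mem_ball_iff_norm] at hr
        refine hy1 r ?_
        have := norm_add_le (r - s) s
        rw [sub_add_cancel] at this
        linarith
      refine aux_cauchy s _ Mg (by linarith) _ ?_ (fun r hr => hbd _ (hin r hr))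
      intro r hr
      have := hgA _ (hin r hr)
      exact (DifferentiableAt.comp (f := fun t : ℂ => (x0, t)) r this
        (by fun_prop)).differentiableWithinAt
  have h3 := norm_add_le (g (x0 + ξ, η) - g (x0, η)) (g (x0, η) - g (x0, 0))
  rw [sub_add_sub_cancel] at h3
  rw [add_sub_cancel_left] at P1
  rw [sub_zero] at P2
  have d1 : 0 < a - a' - A := by linarith
  have d2 : 0 < b - B := by linarith
  have P1' : Mg / (a - a' - A) * ‖ξ‖ ≤ Mg / (a - a' - A) * A := by gcongr
  have P2' : Mg / (b - B) * ‖η‖ ≤ Mg / (b - B) * B := by gcongr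
  calc _ ≤ Mg / (a - a' - A) * A + Mg / (b - B) * B := by linarith
    _ = _ := by ring

lemma aux_analytic (pp : ℤ) (q : ℕ) (S : Set (ℂ × (ℂ × ℂ))) (U : Set (ℂ × (ℂ × ℂ)))
    (f g : ℂ → ℂ × ℂ → ℂ)
    (hfana : AnalyticOnNhd ℂ (fun w : ℂ × (ℂ × ℂ) => f w.1 w.2) S)
    (hgana : AnalyticOnNhd ℂ (fun w : ℂ × (ℂ × ℂ) => g w.1 w.2) S)
    (hmem : ∀ w ∈ U, ∀ j < q, (w.1, (nearIntMap pp q (f w.1) (g w.1))^[j] w.2) ∈ S)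
    (j : ℕ) (hj : j ≤ q) :
    AnalyticOnNhd ℂ
      (fun w : ℂ × (ℂ × ℂ) => (nearIntMap pp q (f w.1) (g w.1))^[j] w.2) U := by
  induction j with
  | zero => intro w hw; simpa using analyticAt_snd
  | succ j ih =>
    intro w hw
    have ih := ih (by omega) w hw
    have hp : AnalyticAt ℂ (fun w : ℂ × (ℂ × ℂ) =>
        (w.1, (nearIntMap pp q (f w.1) (g w.1))^[j] w.2)) w := analyticAt_fst.prod ih
    have hf := AnalyticAt.fun_comp (f := fun w : ℂ × (ℂ × ℂ) =>
      (w.1, (nearIntMap pp q (f w.1) (g w.1))^[j] w.2)) (hfana _ (hmem w hw j (by omega))) hp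
    have hg := AnalyticAt.fun_comp (f := fun w : ℂ × (ℂ × ℂ) =>
      (w.1, (nearIntMap pp q (f w.1) (g w.1))^[j] w.2)) (hgana _ (hmem w hw j (by omega))) hp
    have h1 := AnalyticAt.fun_comp analyticAt_fst ih
    have h2 := AnalyticAt.fun_comp analyticAt_snd ih
    simp only [Function.iterate_succ_apply']
    unfold nearIntMap
    unfold nearIntMap at hf hg h1 h2
    exact (((h1.add analyticAt_const).add h2).add hf).prod (h2.add hg)

lemma aux_implicit (Φ : (ℂ × ℂ) × ℂ → ℂ) (v0 : ℂ × ℂ) (y0 : ℂ)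
    (hΦ : AnalyticAt ℂ Φ (v0, y0)) (hder : deriv (fun y => Φ (v0, y)) y0 ≠ 0)
    (h0 : Φ (v0, y0) = 0) :
    ∃ ψ : ℂ × ℂ → ℂ, AnalyticAt ℂ ψ v0 ∧ ψ v0 = y0 ∧ ∀ᶠ v in nhds v0, Φ (v, ψ v) = 0 := by
  have cdf : ContDiffAt ℂ ⊤ Φ (v0, y0) := hΦ.contDiffAt
  have hd : HasDerivAt (fun y => Φ (v0, y)) (fderiv ℂ Φ (v0, y0) (0, 1)) y0 :=
    HasFDerivAt.comp_hasDerivAt (f := fun y => (v0, y)) y0 hΦ.differentiableAt.hasFDerivAt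
      ((hasDerivAt_const _ v0).prodMk (hasDerivAt_id _))
  rw [hd.deriv] at hder
  set d := fderiv ℂ Φ (v0, y0) (0, 1)
  have if₂ : (fderiv ℂ Φ (v0, y0) ∘L ContinuousLinearMap.inr ℂ (ℂ × ℂ) ℂ).IsInvertible := by
    refine ⟨ContinuousLinearEquiv.unitsEquivAut ℂ (Units.mk0 d hder), ?_⟩
    ext
    simp [d]
  have ne : (⊤ : WithTop ℕ∞) ≠ 0 := by simp
  refine ⟨cdf.implicitFunction ne if₂, ?_, cdf.implicitFunction_apply_self ne if₂, ?_⟩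
  · exact (cdf.contDiffAt_implicitFunction ne if₂).analyticAt
  · filter_upwards [cdf.eventually_apply_implicitFunction ne if₂] with v hv
    rw [hv, h0]

/-- **Lemma (the functions `γ` and `Γ` detecting `(p,q)`-periodic orbits).**
Here `Mf`, `Mg` bound `|f|_{a,b}`, `|g|_{a,b}`. -/
theorem gamma_characterization_of_periodic_orbits
    (pp : ℤ) (q : ℕ) (hq : 0 < q) (hcop : Int.gcd pp q = 1)
    (a a' b Mf Mg : ℝ) (hb : 0 < b) (ha' : a' < a)
    (hMf : 0 ≤ Mf) (hMg : 0 ≤ Mg)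
    (hcond1 : b + Mf ≤ (a - a') / (q : ℝ))
    (hcond2 : Mf + (3 * (q : ℝ) - 1) / 2 * Mg < b)
    (Ω : Set ℂ) (hΩ : IsOpen Ω)
    (f g : ℂ → ℂ × ℂ → ℂ)
    (hfana : AnalyticOnNhd ℂ (fun w : ℂ × (ℂ × ℂ) => f w.1 w.2) (Ω ×ˢ domAB a b))
    (hgana : AnalyticOnNhd ℂ (fun w : ℂ × (ℂ × ℂ) => g w.1 w.2) (Ω ×ˢ domAB a b))
    (hper : ∀ τ ∈ Ω, Per1' (f τ) ∧ Per1' (g τ))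
    (hbound : ∀ τ ∈ Ω, ∀ z ∈ domAB a b, ‖f τ z‖ ≤ Mf ∧ ‖g τ z‖ ≤ Mg) :
    ∃ γ Γ : ℂ → ℂ → ℂ,
      -- `γ` and `Γ` depend analytically on `(f, g)` (and on the base point)
      AnalyticOnNhd ℂ (fun w : ℂ × ℂ => γ w.1 w.2) (Ω ×ˢ strip a') ∧
      AnalyticOnNhd ℂ (fun w : ℂ × ℂ => Γ w.1 w.2) (Ω ×ˢ strip a') ∧
      ∀ τ ∈ Ω,
        Per1 (γ τ) ∧ Per1 (Γ τ) ∧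
        -- sup-norm bounds `|γ|_{a'} ≤ |f| + ((q−1)/2)|g|`, `|Γ|_{a'} ≤ q|g|`
        (∀ x ∈ strip a',
          ‖γ τ x‖ ≤ Mf + ((q : ℝ) - 1) / 2 * Mg ∧ ‖Γ τ x‖ ≤ (q : ℝ) * Mg) ∧
        -- characterization of the `(p,q)`-periodic points in `𝕋_{a'} × D_{b'}`
        (∀ z ∈ domAB a' (b - (q : ℝ) * Mg),
          (nearIntMap pp q (f τ) (g τ))^[q] z = (z.1 + (pp : ℂ), z.2) ↔
            (z.2 = γ τ z.1 ∧ Γ τ z.1 = 0)) ∧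
        -- consequently all `(p,q)`-orbits in `𝕋_{a'} × D_{b'}` lie in `𝕋_{a'} × D_{b''}`
        (∀ z ∈ domAB a' (b - (q : ℝ) * Mg),
          (nearIntMap pp q (f τ) (g τ))^[q] z = (z.1 + (pp : ℂ), z.2) →
            ‖z.2‖ ≤ Mf + ((q : ℝ) - 1) / 2 * Mg) ∧
        -- approximation of `Γ` by the Birkhoff sum of `g` along the `1/q`-orbit
        (∀ x ∈ strip a',
          ‖Γ τ x - ∑ k ∈ Finset.range q, g τ (x + (k : ℂ) / (q : ℂ), 0)‖ ≤
            (q : ℝ) * ((2 * (q : ℝ) * Mf + (q : ℝ) * ((q : ℝ) - 1) * Mg) /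
                (a - a' - (2 * (q : ℝ) * Mf + (q : ℝ) * ((q : ℝ) - 1) * Mg)) +
              (Mf + (3 * (q : ℝ) - 1) / 2 * Mg) /
                (b - (Mf + (3 * (q : ℝ) - 1) / 2 * Mg))) * Mg) ∧
        -- estimate of the Lyapunov determinant along the curve `y = γ(x)`
        (∀ x ∈ strip a',
          ‖ContinuousLinearMap.det
              (fderiv ℂ ((nearIntMap pp q (f τ) (g τ))^[q]) (x, γ τ x) -
                ContinuousLinearMap.id ℂ (ℂ × ℂ)) +
            (q : ℂ) * deriv (Γ τ) x‖ ≤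
            (2 * (q : ℝ) * Mf + (q : ℝ) * ((q : ℝ) - 1) * Mg) / 2 *
              ‖deriv (Γ τ) x‖ / (b - (q : ℝ) * Mg - ‖γ τ x‖)) := by
  have hq' : (0 : ℝ) < q := by exact_mod_cast hq
  have hq1 : (1 : ℝ) ≤ q := by exact_mod_cast hq
  have hqc : (q : ℂ) ≠ 0 := by exact_mod_cast hq.ne'
  have hpq : (q : ℂ) * ((pp : ℂ) / q) = pp := by field_simp
  have hqMg : 0 ≤ (q : ℝ) * Mg := by positivity
  set b' := b - (q : ℝ) * Mg with hb'
  set b'' := Mf + ((q : ℝ) - 1) / 2 * Mg with hb''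
  have hb''0 : 0 ≤ b'' := by
    have : 0 ≤ ((q : ℝ) - 1) / 2 := by linarith
    positivity
  have hbb : b'' < b' := by
    simp only [hb', hb'']; linarith
  have horb := fun τ hτ => aux_orbit pp q hq a a' b Mf Mg hMf hMg hb hcond1 (f τ) (g τ)
    (hbound τ hτ)
  -- the iterate is analytic
  have hanaj := aux_analytic pp q (Ω ×ˢ domAB a b) (Ω ×ˢ domAB a' b') f g hfana hgana
    (fun w hw j hj => ⟨hw.1, (horb w.1 hw.1 w.2 hw.2 j hj.le).1⟩)
  have hana := hanaj q le_rfl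
  set N : ℂ → ℂ × ℂ → ℂ × ℂ := fun τ => (nearIntMap pp q (f τ) (g τ))^[q] with hN
  have hNana : ∀ τ ∈ Ω, ∀ z ∈ domAB a' b', DifferentiableAt ℂ (N τ) z := by
    intro τ hτ z hz
    have h1 := (hana (τ, z) ⟨hτ, hz⟩).differentiableAt
    exact DifferentiableAt.comp (f := fun z : ℂ × ℂ => (τ, z)) z h1 (by fun_prop)
  have hfq : ∀ τ ∈ Ω, ∀ z ∈ domAB a' b', ‖(N τ z).1 - z.1 - pp - q * z.2‖ ≤ q * b'' := by
    intro τ hτ z hz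
    have := (horb τ hτ z hz q le_rfl).2.2.2
    rw [hpq] at this
    refine this.trans (le_of_eq ?_)
    simp only [hb'']; ring
  have hgq : ∀ τ ∈ Ω, ∀ z ∈ domAB a' b', ‖(N τ z).2 - z.2‖ ≤ q * Mg :=
    fun τ hτ z hz => (horb τ hτ z hz q le_rfl).2.1
  -- the fixed point map
  set T : ℂ → ℂ → ℂ → ℂ := fun τ x y => - ((N τ (x, y)).1 - x - pp - q * y) / q with hT
  have hTfix : ∀ τ x y, T τ x y = y ↔ (N τ (x, y)).1 = x + pp := by
    intro τ x y
    simp only [hT]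
    rw [div_eq_iff hqc]
    constructor
    · intro h; linear_combination -h
    · intro h; linear_combination -h
  have hTd : ∀ τ ∈ Ω, ∀ x ∈ strip a', DifferentiableOn ℂ (T τ x) (Metric.ball 0 b') := by
    intro τ hτ x hx y hy
    rw [mem_ball_zero_iff] at hy
    have h1 := hNana τ hτ (x, y) ⟨hx, hy⟩
    have h2 : DifferentiableAt ℂ (fun y => (N τ (x, y))) y :=
      DifferentiableAt.comp (f := fun y : ℂ => (x, y)) y h1 (by fun_prop)
    have h3 : DifferentiableAt ℂ (fun y => (N τ (x, y)).1) y := h2.fst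
    apply DifferentiableAt.differentiableWithinAt
    simp only [hT]
    fun_prop
  have hTb : ∀ τ ∈ Ω, ∀ x ∈ strip a', ∀ y, ‖y‖ < b' → ‖T τ x y‖ ≤ b'' := by
    intro τ hτ x hx y hy
    have h1 := hfq τ hτ (x, y) ⟨hx, hy⟩
    simp only [hT]
    rw [norm_div, norm_neg, Complex.norm_natCast, div_le_iff₀ hq', mul_comm b'']
    exact h1
  have hex : ∀ τ ∈ Ω, ∀ x ∈ strip a', ∃ y, ‖y‖ < b' ∧ T τ x y = y := fun τ hτ x hx =>
    aux_exists_fixed b' b'' hb''0 hbb (T τ x) (hTd τ hτ x hx) (hTb τ hτ x hx)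
  have huniq : ∀ τ ∈ Ω, ∀ x ∈ strip a', ∀ y y2, ‖y‖ < b' → ‖y2‖ < b' → T τ x y = y →
      T τ x y2 = y2 → y2 = y := fun τ hτ x hx y y2 h1 h2 h3 h4 =>
    aux_unique_fixed b' b'' hbb (T τ x) (hTd τ hτ x hx) (hTb τ hτ x hx) y y2 h1 h2 h3 h4
  classical
  have hγex : ∃ γ : ℂ → ℂ → ℂ, ∀ τ x,
      (τ ∈ Ω ∧ x ∈ strip a' → ‖γ τ x‖ < b' ∧ T τ x (γ τ x) = γ τ x) ∧
      (¬ (τ ∈ Ω ∧ x ∈ strip a') → γ τ x = 0) := by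
    refine ⟨fun τ x => if h : τ ∈ Ω ∧ x ∈ strip a' then (hex τ h.1 x h.2).choose else 0, ?_⟩
    intro τ x
    constructor
    · intro h; simp only [dif_pos h]; exact (hex τ h.1 x h.2).choose_spec
    · intro h; simp only [dif_neg h]
  obtain ⟨γ, hγ⟩ := hγex
  have hγ1 : ∀ τ ∈ Ω, ∀ x ∈ strip a', ‖γ τ x‖ < b' := fun τ hτ x hx => ((hγ τ x).1 ⟨hτ, hx⟩).1
  have hγ2 : ∀ τ ∈ Ω, ∀ x ∈ strip a', T τ x (γ τ x) = γ τ x :=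
    fun τ hτ x hx => ((hγ τ x).1 ⟨hτ, hx⟩).2
  have hγ3 : ∀ τ ∈ Ω, ∀ x ∈ strip a', ‖γ τ x‖ ≤ b'' := fun τ hτ x hx => by
    have := hTb τ hτ x hx _ (hγ1 τ hτ x hx)
    rwa [hγ2 τ hτ x hx] at this
  have hγm : ∀ τ ∈ Ω, ∀ x ∈ strip a', (x, γ τ x) ∈ domAB a' b' :=
    fun τ hτ x hx => ⟨hx, hγ1 τ hτ x hx⟩
  set Γ : ℂ → ℂ → ℂ := fun τ x =>
    if τ ∈ Ω ∧ x ∈ strip a' then (N τ (x, γ τ x)).2 - γ τ x else 0 with hΓ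
  have hΓ1 : ∀ τ ∈ Ω, ∀ x ∈ strip a', Γ τ x = (N τ (x, γ τ x)).2 - γ τ x :=
    fun τ hτ x hx => if_pos ⟨hτ, hx⟩
  have hstrip_open : IsOpen (strip a') :=
    isOpen_lt (f := fun z : ℂ => |z.im|) (by fun_prop) continuous_const
  have hopen : IsOpen (Ω ×ˢ strip a') := hΩ.prod hstrip_open
  have hγana : AnalyticOnNhd ℂ (fun w : ℂ × ℂ => γ w.1 w.2) (Ω ×ˢ strip a') := by
    rintro ⟨τ, x⟩ ⟨hτ, hx⟩
    simp only at hτ hx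
    have l1 : AnalyticAt ℂ (fun u : (ℂ × ℂ) × ℂ => u.1.1) ((τ, x), γ τ x) :=
      AnalyticAt.fun_comp analyticAt_fst analyticAt_fst
    have l2 : AnalyticAt ℂ (fun u : (ℂ × ℂ) × ℂ => u.1.2) ((τ, x), γ τ x) :=
      AnalyticAt.fun_comp analyticAt_snd analyticAt_fst
    have l3 : AnalyticAt ℂ (fun u : (ℂ × ℂ) × ℂ => u.2) ((τ, x), γ τ x) := analyticAt_snd
    have hpt : AnalyticAt ℂ (fun u : (ℂ × ℂ) × ℂ => ((u.1.1, (u.1.2, u.2)) : ℂ × (ℂ × ℂ)))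
        ((τ, x), γ τ x) := (l1.prod (l2.prod l3))
    have hNa := AnalyticAt.fun_comp
      (f := fun u : (ℂ × ℂ) × ℂ => ((u.1.1, (u.1.2, u.2)) : ℂ × (ℂ × ℂ)))
      (hana (τ, (x, γ τ x)) ⟨hτ, hγm τ hτ x hx⟩) hpt
    have hNa1 := AnalyticAt.fun_comp analyticAt_fst hNa
    obtain ⟨ψ, hψ1, hψ2, hψ3⟩ := aux_implicit
      (fun u => u.2 - T u.1.1 u.1.2 u.2) (τ, x) (γ τ x) (by
        simp only [hT, hN]
        exact l3.sub ((((hNa1.sub l2).sub analyticAt_const).sub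
          (analyticAt_const.mul l3)).neg.div analyticAt_const hqc))
      (aux_deriv_ne b' b'' hbb (T τ x) (hTd τ hτ x hx) (hTb τ hτ x hx) _ (hγ1 τ hτ x hx)
        (hγ2 τ hτ x hx)) (by simp only; rw [hγ2 τ hτ x hx, sub_self])
    refine hψ1.congr ?_
    have hlt : ∀ᶠ v in nhds (τ, x), ‖ψ v‖ < b' := by
      refine hψ1.continuousAt.norm.eventually_lt_const ?_
      simp only [hψ2]; exact hγ1 τ hτ x hx
    filter_upwards [hψ3, hlt, hopen.mem_nhds ⟨hτ, hx⟩] with v h1 h2 h3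
    exact huniq v.1 h3.1 v.2 h3.2 (γ v.1 v.2) (ψ v) (hγ1 _ h3.1 _ h3.2) h2 (hγ2 _ h3.1 _ h3.2)
      (sub_eq_zero.1 h1).symm
  have hΓana : AnalyticOnNhd ℂ (fun w : ℂ × ℂ => Γ w.1 w.2) (Ω ×ˢ strip a') := by
    rintro ⟨τ, x⟩ ⟨hτ, hx⟩
    simp only at hτ hx
    have h0 := hγana (τ, x) ⟨hτ, hx⟩
    have hpt : AnalyticAt ℂ (fun u : ℂ × ℂ => ((u.1, (u.2, γ u.1 u.2)) : ℂ × (ℂ × ℂ)))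
        (τ, x) := analyticAt_fst.prod (analyticAt_snd.prod h0)
    have hNa := AnalyticAt.fun_comp
      (f := fun u : ℂ × ℂ => ((u.1, (u.2, γ u.1 u.2)) : ℂ × (ℂ × ℂ)))
      (hana (τ, (x, γ τ x)) ⟨hτ, hγm τ hτ x hx⟩) hpt
    have hNa1 := AnalyticAt.fun_comp analyticAt_snd hNa
    refine (hNa1.sub h0).congr ?_
    filter_upwards [hopen.mem_nhds ⟨hτ, hx⟩] with v h3
    exact (hΓ1 v.1 h3.1 v.2 h3.2).symm
  have hchar : ∀ τ ∈ Ω, ∀ z ∈ domAB a' b',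
      N τ z = (z.1 + (pp : ℂ), z.2) ↔ (z.2 = γ τ z.1 ∧ Γ τ z.1 = 0) := by
    intro τ hτ z hz
    have hx : z.1 ∈ strip a' := hz.1
    constructor
    · intro h
      have h1 : z.2 = γ τ z.1 := by
        refine huniq τ hτ z.1 hx _ _ (hγ1 τ hτ _ hx) hz.2 (hγ2 τ hτ _ hx) ?_
        rw [hTfix]; exact congrArg Prod.fst h
      refine ⟨h1, ?_⟩
      rw [hΓ1 τ hτ _ hx, ← h1, sub_eq_zero]
      rw [show (z.1, z.2) = z from rfl, h]
    · rintro ⟨h1, h2⟩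
      rw [hΓ1 τ hτ _ hx, ← h1, sub_eq_zero] at h2
      refine Prod.ext ?_ h2
      have := hγ2 τ hτ _ hx
      rw [hTfix, ← h1] at this
      exact this
  have hst1 : ∀ x : ℂ, x + 1 ∈ strip a' ↔ x ∈ strip a' := by
    intro x; simp [strip]
  have hNper : ∀ τ ∈ Ω, ∀ x y, N τ (x + 1, y) = ((N τ (x, y)).1 + 1, (N τ (x, y)).2) :=
    fun τ hτ x y => aux_per pp q (f τ) (g τ) (hper τ hτ).1 (hper τ hτ).2 x y q
  have hγper : ∀ τ ∈ Ω, Per1 (γ τ) := by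
    intro τ hτ x
    by_cases hx : x ∈ strip a'
    · refine huniq τ hτ x hx _ _ (hγ1 τ hτ x hx) (hγ1 τ hτ _ ((hst1 x).2 hx)) (hγ2 τ hτ x hx) ?_
      have := hγ2 τ hτ _ ((hst1 x).2 hx)
      rw [hTfix, hNper τ hτ] at this
      rw [hTfix]
      simp only at this
      linear_combination this
    · rw [(hγ τ x).2 (fun h => hx h.2), (hγ τ (x + 1)).2 (fun h => hx ((hst1 x).1 h.2))]
  have hΓper : ∀ τ ∈ Ω, Per1 (Γ τ) := by
    intro τ hτ x
    simp only [hΓ, hst1, hγper τ hτ x, hNper τ hτ]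
  refine ⟨γ, Γ, hγana, hΓana, ?_⟩
  intro τ hτ
  refine ⟨hγper τ hτ, hΓper τ hτ, ?_, hchar τ hτ, ?_, ?_, ?_⟩
  · intro x hx
    refine ⟨hγ3 τ hτ x hx, ?_⟩
    rw [hΓ1 τ hτ x hx]
    exact hgq τ hτ _ (hγm τ hτ x hx)
  · intro z hz h
    rw [((hchar τ hτ z hz).1 h).1]
    exact hγ3 τ hτ z.1 hz.1
  · intro x hx
    set A := 2 * (q : ℝ) * Mf + (q : ℝ) * ((q : ℝ) - 1) * Mg with hA
    set B := Mf + (3 * (q : ℝ) - 1) / 2 * Mg with hB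
    have hAe : A = 2 * (q * b'') := by simp only [hA, hb'']; ring
    have hBe : B = b'' + q * Mg := by simp only [hB, hb'']; ring
    have hc : (b + Mf) * q ≤ a - a' := (le_div_iff₀ hq').1 hcond1
    have hAlt : A < a - a' := by
      refine lt_of_lt_of_le ?_ hc
      have : 2 * b'' < b + Mf := by
        simp only [hb'']; linarith
      rw [hAe]; nlinarith
    rw [hΓ1 τ hτ x hx, hN]
    simp only
    rw [aux_sum pp q (f τ) (g τ) (x, γ τ x) q, ← aux_reindex pp q hq hcop (g τ) (hper τ hτ).2 x,
      ← Finset.sum_sub_distrib]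
    have hgd : DifferentiableOn ℂ (g τ) (domAB a b) := by
      intro z hz
      have h1 := (hgana (τ, z) ⟨hτ, hz⟩).differentiableAt
      exact (DifferentiableAt.comp (f := fun z : ℂ × ℂ => (τ, z)) z h1
        (by fun_prop)).differentiableWithinAt
    have hterm : ∀ k ∈ Finset.range q,
        ‖g τ ((nearIntMap pp q (f τ) (g τ))^[k] (x, γ τ x)) -
          g τ (x + (k : ℂ) * ((pp : ℂ) / q), 0)‖ ≤ (A / (a - a' - A) + B / (b - B)) * Mg := by
      intro k hk
      have hkq : k ≤ q := (Finset.mem_range.1 hk).le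
      have hkq' : (k : ℝ) ≤ q := by exact_mod_cast hkq
      obtain ⟨-, o2, -, o4⟩ := horb τ hτ _ (hγm τ hτ x hx) k hkq
      set w := (nearIntMap pp q (f τ) (g τ))^[k] (x, γ τ x)
      simp only at o2 o4
      have hg3 := hγ3 τ hτ x hx
      have him : |(x + (k : ℂ) * ((pp : ℂ) / q)).im| < a' := by
        have : ((k : ℂ) * ((pp : ℂ) / q)).im = 0 := by
          rw [show ((k : ℂ) * ((pp : ℂ) / q)) = (((k : ℝ) * ((pp : ℝ) / (q : ℝ)) : ℝ) : ℂ) by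
            push_cast; rfl]
          exact Complex.ofReal_im _
        rw [Complex.add_im, this, add_zero]; exact hx
      have hw : w = ((x + (k : ℂ) * ((pp : ℂ) / q)) + (w.1 - (x + (k : ℂ) * ((pp : ℂ) / q))),
          w.2) := by rw [add_sub_cancel]
      rw [hw]
      refine aux_gdiff a a' b A B Mg (g τ) hgd (fun z hz => (hbound τ hτ z hz).2) hMg hAlt hcond2
        _ _ _ him ?_ ?_
      · have e : w.1 - (x + (k : ℂ) * ((pp : ℂ) / q)) =
            (w.1 - x - k * ((pp : ℂ) / q) - k * γ τ x) + k * γ τ x := by ring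
        rw [e]
        refine (norm_add_le _ _).trans ?_
        rw [norm_mul, Complex.norm_natCast]
        have e1 : (k : ℝ) * ‖γ τ x‖ ≤ q * b'' := by gcongr
        have e2 : (k : ℝ) * Mf + (k : ℝ) * ((k : ℝ) - 1) / 2 * Mg ≤ q * b'' := by
          have e3 : (k : ℝ) * ((k : ℝ) - 1) ≤ q * ((q : ℝ) - 1) := by
            rcases Nat.eq_zero_or_pos k with rfl | hk0
            · simp; nlinarith
            · have : (1 : ℝ) ≤ k := by exact_mod_cast hk0
              nlinarith
          have e4 : (k : ℝ) * Mf ≤ q * Mf := by gcongr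
          have e5 := mul_le_mul_of_nonneg_right e3 hMg
          simp only [hb'']; linarith
        rw [hAe]; linarith
      · have e : w.2 = (w.2 - γ τ x) + γ τ x := by ring
        rw [e]
        refine (norm_add_le _ _).trans ?_
        have : (k : ℝ) * Mg ≤ q * Mg := by gcongr
        rw [hBe]; linarith
    refine (norm_sum_le _ _).trans ((Finset.sum_le_sum hterm).trans (le_of_eq ?_))
    rw [Finset.sum_const, Finset.card_range, nsmul_eq_mul, mul_assoc]
  · intro x hx
    have hγd : DifferentiableAt ℂ (γ τ) x := by
      have h1 := (hγana (τ, x) ⟨hτ, hx⟩).differentiableAt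
      exact DifferentiableAt.comp (f := fun z : ℂ => (τ, z)) x h1 (by fun_prop)
    have hev := hstrip_open.mem_nhds hx
    have hdet := aux_det_formula (N τ) (γ τ) (Γ τ) x pp q (hNana τ hτ _ (hγm τ hτ x hx)) hγd
      (by
        filter_upwards [hev] with s hs
        exact (hTfix τ s _).1 (hγ2 τ hτ s hs))
      (by
        filter_upwards [hev] with s hs
        exact hΓ1 τ hτ s hs)
    rw [hdet, norm_mul, norm_neg]
    have hR : 0 < b' - ‖γ τ x‖ := by linarith [hγ1 τ hτ x hx]
    have hin : ∀ y ∈ Metric.ball (γ τ x) (b' - ‖γ τ x‖), ‖y‖ < b' := by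
      intro y hy
      rw [mem_ball_iff_norm] at hy
      have := norm_add_le (y - γ τ x) (γ τ x)
      rw [sub_add_cancel] at this
      linarith
    have hca := aux_cauchy (γ τ x) (b' - ‖γ τ x‖) (q * b'') hR
      (fun y => (N τ (x, y)).1 - x - pp - q * y) (by
        intro y hy
        have h1 := hNana τ hτ (x, y) ⟨hx, hin y hy⟩
        have h2 : DifferentiableAt ℂ (fun y => (N τ (x, y))) y :=
          DifferentiableAt.comp (f := fun y : ℂ => (x, y)) y h1 (by fun_prop)
        have h3 : DifferentiableAt ℂ (fun y => (N τ (x, y)).1) y := h2.fst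
        apply DifferentiableAt.differentiableWithinAt
        fun_prop)
      (fun y hy => hfq τ hτ (x, y) ⟨hx, hin y hy⟩)
    refine (mul_le_mul_of_nonneg_right hca (norm_nonneg _)).trans (le_of_eq ?_)
    simp only [hb'']; ring

end
end
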